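/- arXiv:1002.2786 — 2 statements merged into one kernel-verified Lean document; each statement's English description precedes it below -/
import Mathlib

section
/- There is no algorithm (partial recursive function on codes) that, on input of a code of a finite presentation P = (m, R) whose presented group is nontrivial, halts and outputs an index i < m such that the generator corresponding to i (the image of the i-th free generator in the presented group) is nontrivial (≠ 1). -/
/-- A word in `m` generators. -/
abbrev Word (m : ℕ) : Type := List (Fin m × Bool)

/-- A finite presentation: a number of generators together with a finite list of relator words. -/
abbrev FinPres : Type := Σ m : ℕ, List (Word m)

/-- The set of relators of a finite presentation, as elements of the free group. -/
def FinPres.rels (P : FinPres) : Set (FreeGroup (Fin P.1)) :=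
  {x | ∃ r ∈ P.2, x = FreeGroup.mk r}

/-- The group presented by a finite presentation. -/
abbrev FinPres.Grp (P : FinPres) : Type := PresentedGroup P.rels

/-- The projection from the free group onto the presented group. -/
def FinPres.proj (P : FinPres) : FreeGroup (Fin P.1) →* P.Grp :=
  PresentedGroup.mk P.rels

/-- The `n`-th recursively enumerable set: the domain of the `n`-th partial recursive
function under the canonical numbering. -/
def W (n : ℕ) : Set ℕ := {x | ((Denumerable.ofNat Nat.Partrec.Code n).eval x).Dom}

/-- The set of orders of nontrivial torsion elements of a group. -/
def TorOrd (G : Type*) [Group G] : Set ℕ := {n | 2 ≤ n ∧ ∃ g : G, orderOf g = n}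

namespace NontrivialGenerator

/-- A fixed word in two letters, used to conjugate an involution `v` to another involution. -/
def conjWord {G : Type*} [Group G] (v y : G) : G := y * v * y * v * y * y

/-- The relations expressing that `y` makes `s` a consequence of `v`. -/
def Links {G : Type*} [Group G] (v y s : G) : Prop :=
  y ^ 3 = 1 ∧ (v * y) ^ 5 = 1 ∧ s = conjWord v y * v * (conjWord v y)⁻¹

theorem Links.map {G H : Type*} [Group G] [Group H] (f : G →* H) {v y s : G} (h : Links v y s) :
    Links (f v) (f y) (f s) := by
  obtain ⟨h3, h5, rfl⟩ := h
  refine ⟨by rw [← map_pow, h3, map_one], by rw [← map_mul, ← map_pow, h5, map_one], ?_⟩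
  simp [conjWord]

theorem Links.eq_one {G : Type*} [Group G] {v y s : G} (h : Links v y s) (hv : v = 1) :
    y = 1 ∧ s = 1 := by
  obtain ⟨h3, h5, rfl⟩ := h
  subst hv
  rw [one_mul] at h5
  refine ⟨?_, by simp⟩
  calc y = (y ^ 3) ^ 2 * (y ^ 5)⁻¹ := by group
    _ = 1 := by rw [h3, h5]; simp

/-- The homomorphism from the Klein four-group determined by two commuting involutions. -/
def kleinHom {G : Type*} [Group G] (v s : G) (hv : v * v = 1) (hs : s * s = 1)
    (hc : v * s = s * v) : Multiplicative (ZMod 2) × Multiplicative (ZMod 2) →* G :=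
  MonoidHom.mk' (fun z => v ^ (z.1.toAdd.val) * s ^ (z.2.toAdd.val)) (by
    have h2 : ∀ z : Multiplicative (ZMod 2), z = 1 ∨ z = Multiplicative.ofAdd 1 := by decide
    have e1 : (Multiplicative.ofAdd (1 : ZMod 2)).toAdd.val = 1 := rfl
    have e2 : (Multiplicative.ofAdd (1 : ZMod 2) * Multiplicative.ofAdd 1).toAdd.val = 0 := rfl
    have e3 : (Multiplicative.toAdd (1 : Multiplicative (ZMod 2))).val = 0 := rfl
    rintro ⟨a, b⟩ ⟨c, d⟩
    have hv' : ∀ x, v * (v * x) = x := fun x => by rw [← mul_assoc, hv, one_mul]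
    have hc' : ∀ x, s * (v * x) = v * (s * x) := fun x => by
      rw [← mul_assoc, ← hc, mul_assoc]
    rcases h2 a with rfl | rfl <;> rcases h2 b with rfl | rfl <;>
      rcases h2 c with rfl | rfl <;> rcases h2 d with rfl | rfl <;>
      simp only [Prod.mk_mul_mk, one_mul, mul_one, e1, e2, e3, pow_one, pow_zero, mul_assoc,
        hv, hs, hv', ← hc, hc'])

theorem kleinHom_injective {G : Type*} [Group G] {v s : G} (hv : v * v = 1) (hs : s * s = 1)
    (hc : v * s = s * v) (v1 : v ≠ 1) (s1 : s ≠ 1) (vs : v ≠ s) :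
    Function.Injective (kleinHom v s hv hs hc) := by
  have h2 : ∀ z : Multiplicative (ZMod 2), z = 1 ∨ z = Multiplicative.ofAdd 1 := by decide
  have e1 : (Multiplicative.ofAdd (1 : ZMod 2)).toAdd.val = 1 := rfl
  have e3 : (Multiplicative.toAdd (1 : Multiplicative (ZMod 2))).val = 0 := rfl
  rw [injective_iff_map_eq_one]
  rintro ⟨a, b⟩ h
  have hne : v * s ≠ 1 := fun h => vs ((mul_eq_one_iff_eq_inv.1 h).trans
    (mul_eq_one_iff_eq_inv.1 hs).symm)
  change v ^ _ * s ^ _ = 1 at h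
  rcases h2 a with rfl | rfl <;> rcases h2 b with rfl | rfl <;>
    simp only [e1, e3, pow_one, pow_zero, one_mul, mul_one] at h
  · rfl
  · exact absurd h s1
  · exact absurd h v1
  · exact absurd h hne

/-- The connecting element `y` in a solution of `Links v y s` in the symmetric group. -/
def linkY : Equiv.Perm (Fin 5) := Equiv.swap 1 2 * Equiv.swap 2 4

/-- The involution `v` in a solution of `Links v y s` in the symmetric group. -/
def linkV : Equiv.Perm (Fin 5) := Equiv.swap 0 1 * Equiv.swap 2 3

/-- The involution `s` in a solution of `Links v y s` in the symmetric group. -/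
def linkS : Equiv.Perm (Fin 5) := Equiv.swap 0 3 * Equiv.swap 1 2

set_option maxRecDepth 10000 in
theorem links_perm : Links linkV linkY linkS := by
  refine ⟨?_, ?_, ?_⟩
  · simp only [pow_succ, pow_zero, one_mul]; decide
  · simp only [pow_succ, pow_zero, one_mul]; decide
  · decide

/-- Two groups as a family indexed by `Bool`. -/
def pairFamily (G H : Type) : Bool → Type
  | true => G
  | false => H

instance (G H : Type) [Group G] [Group H] : ∀ b, Group (pairFamily G H b)
  | true => inferInstanceAs (Group G)
  | false => inferInstanceAs (Group H)

theorem exists_amalgam {K G H : Type} [Group K] [Group G] [Group H] (f : K →* G) (g : K →* H)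
    (hf : Function.Injective f) (hg : Function.Injective g) :
    ∃ (A : Type) (_ : Group A) (ι : G →* A) (κ : H →* A),
      Function.Injective ι ∧ ∀ z, ι (f z) = κ (g z) := by
  let φ : ∀ b, K →* pairFamily G H b := fun b => match b with
    | true => f
    | false => g
  have hφ : ∀ b, Function.Injective (φ b) := fun b => match b with
    | true => hf
    | false => hg
  exact ⟨Monoid.PushoutI φ, inferInstance, Monoid.PushoutI.of (φ := φ) true,
    Monoid.PushoutI.of (φ := φ) false, Monoid.PushoutI.of_injective hφ true,
    fun z => (Monoid.PushoutI.of_apply_eq_base φ true z).trans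
      (Monoid.PushoutI.of_apply_eq_base φ false z).symm⟩

theorem exists_link {G : Type} [Group G] {v s : G} (hv : v * v = 1) (hs : s * s = 1)
    (hc : v * s = s * v) (v1 : v ≠ 1) (s1 : s ≠ 1) (vs : v ≠ s) :
    ∃ (G' : Type) (_ : Group G') (ι : G →* G') (y : G'),
      Function.Injective ι ∧ Links (ι v) y (ι s) := by
  have lv : linkV * linkV = 1 := by decide
  have ls : linkS * linkS = 1 := by decide
  have lc : linkV * linkS = linkS * linkV := by decide
  obtain ⟨A, _, ι, κ, inj, key⟩ := exists_amalgam _ _ (kleinHom_injective hv hs hc v1 s1 vs)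
    (kleinHom_injective lv ls lc (by decide) (by decide) (by decide))
  have e1 : (Multiplicative.ofAdd (1 : ZMod 2)).toAdd.val = 1 := rfl
  have e3 : (Multiplicative.toAdd (1 : Multiplicative (ZMod 2))).val = 0 := rfl
  have kv : ι v = κ linkV := by
    have := key (Multiplicative.ofAdd 1, 1)
    simpa only [kleinHom, MonoidHom.mk'_apply, e1, e3, pow_one, pow_zero, mul_one] using this
  have ks : ι s = κ linkS := by
    have := key (1, Multiplicative.ofAdd 1)
    simpa only [kleinHom, MonoidHom.mk'_apply, e1, e3, pow_one, pow_zero, one_mul] using this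
  refine ⟨A, inferInstance, ι, κ linkY, inj, ?_⟩
  rw [kv, ks]
  exact links_perm.map κ

theorem exists_links {ι : Type} (l : List ι) {G : Type} [Group G] (v s : ι → G)
    (hv : ∀ i ∈ l, v i * v i = 1) (hs : ∀ i ∈ l, s i * s i = 1)
    (hc : ∀ i ∈ l, v i * s i = s i * v i) (v1 : ∀ i ∈ l, v i ≠ 1) (s1 : ∀ i ∈ l, s i ≠ 1)
    (vs : ∀ i ∈ l, v i ≠ s i) :
    ∃ (G' : Type) (_ : Group G') (e : G →* G') (y : ι → G'),
      Function.Injective e ∧ ∀ i ∈ l, Links (e (v i)) (y i) (e (s i)) := by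
  classical
  induction l with
  | nil => exact ⟨G, _, MonoidHom.id G, 1, Function.injective_id, by simp⟩
  | cons a l ih =>
    obtain ⟨G₁, _, e₁, y₁, inj₁, h₁⟩ := ih (fun i hi => hv i (.tail _ hi))
      (fun i hi => hs i (.tail _ hi)) (fun i hi => hc i (.tail _ hi))
      (fun i hi => v1 i (.tail _ hi)) (fun i hi => s1 i (.tail _ hi))
      (fun i hi => vs i (.tail _ hi))
    have ha : a ∈ a :: l := List.mem_cons_self
    obtain ⟨G₂, _, e₂, z, inj₂, h₂⟩ := exists_link (v := e₁ (v a)) (s := e₁ (s a))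
      (by rw [← map_mul, hv a ha, map_one]) (by rw [← map_mul, hs a ha, map_one])
      (by rw [← map_mul, hc a ha, map_mul])
      ((map_ne_one_iff e₁ inj₁).2 (v1 a ha)) ((map_ne_one_iff e₁ inj₁).2 (s1 a ha))
      (inj₁.ne (vs a ha))
    refine ⟨G₂, _, e₂.comp e₁, fun i => if i ∈ l then e₂ (y₁ i) else z,
      inj₂.comp inj₁, fun i hi => ?_⟩
    by_cases hl : i ∈ l
    · simpa [hl] using (h₁ i hl).map e₂
    · obtain rfl : i = a := by simpa [hl] using hi
      simpa [hl] using h₂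

/-- Index set for the `ℤ`-orbits of `Pt`: a subset of `ℤ` (the colouring of the orbit) and a tag
ensuring that every colouring occurs often enough. -/
abbrev Orb : Type := Set ℤ × Set ℤ

/-- A free `ℤ`-set on which every colouring of an orbit occurs continuum many times. -/
abbrev Pt : Type := ℤ × Orb

/-- The coloured points. -/
def Colored (z : Pt) : Prop := z.1 ∈ z.2.1

/-- The colouring of an `mℤ`-orbit in `Pt`. -/
def trace (m : ℕ) (z : Fin m × Orb) : Set ℤ := {k | k * m + (z.1 : ℤ) ∈ z.2.1}

theorem mk_trace_fiber (m : ℕ) (hm : 0 < m) (E : Set ℤ) :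
    Cardinal.mk {z : Fin m × Orb // trace m z = E} = Cardinal.mk (Set ℤ) := by
  have hm' : (m : ℤ) ≠ 0 := by exact_mod_cast hm.ne'
  apply le_antisymm
  · have hfin : Cardinal.mk (Fin m) ≤ Cardinal.mk (Set ℤ) :=
      (Cardinal.mk_le_aleph0).trans (Cardinal.aleph0_le_mk _)
    calc Cardinal.mk {z : Fin m × Orb // trace m z = E} ≤ Cardinal.mk (Fin m × Orb) :=
          Cardinal.mk_subtype_le _
      _ = Cardinal.mk (Fin m) * (Cardinal.mk (Set ℤ) * Cardinal.mk (Set ℤ)) := by simp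
      _ ≤ Cardinal.mk (Set ℤ) * (Cardinal.mk (Set ℤ) * Cardinal.mk (Set ℤ)) := by gcongr
      _ = Cardinal.mk (Set ℤ) := by
        rw [Cardinal.mul_eq_self (Cardinal.aleph0_le_mk _),
          Cardinal.mul_eq_self (Cardinal.aleph0_le_mk _)]
  · refine Cardinal.mk_le_of_injective
      (f := fun c : Set ℤ => ⟨(⟨0, hm⟩, ({n | n / m ∈ E}, c)), ?_⟩) ?_
    · ext k
      simp [trace, Int.mul_ediv_cancel _ hm']
    · intro c c' h
      simpa using h

theorem exists_trace_equiv (m l : ℕ) (hm : 0 < m) (hl : 0 < l) (x : Fin m × Orb)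
    (y : Fin l × Orb) (hxy : trace m x = trace l y) :
    ∃ σ : Fin m × Orb ≃ Fin l × Orb, (∀ z, trace l (σ z) = trace m z) ∧ σ x = y := by
  classical
  have h : ∀ E, Nonempty ({z : Fin m × Orb // trace m z = E} ≃
      {z : Fin l × Orb // trace l z = E}) := fun E =>
    Cardinal.eq.1 ((mk_trace_fiber m hm E).trans (mk_trace_fiber l hl E).symm)
  let σ₀ : Fin m × Orb ≃ Fin l × Orb := (Equiv.sigmaFiberEquiv (trace m)).symm.trans
    ((Equiv.sigmaCongrRight fun E => (h E).some).trans (Equiv.sigmaFiberEquiv (trace l)))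
  have h₀ : ∀ z, trace l (σ₀ z) = trace m z := fun z => ((h (trace m z)).some ⟨z, rfl⟩).2
  refine ⟨σ₀.trans (Equiv.swap (σ₀ x) y), fun z => ?_, by simp⟩
  rw [Equiv.trans_apply, Equiv.swap_apply_def]
  split_ifs with h1 h2
  · rw [← hxy, ← h₀ x, ← h1, h₀]
  · rw [h₀, hxy, ← h2, h₀]
  · exact h₀ z

theorem exists_shift_equiv (m l a b : ℕ) (ha : a < m) (hb : b < l) (E E' : Set ℤ)
    (h : ∀ k : ℤ, k * m + a ∈ E ↔ k * l + b ∈ E') :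
    ∃ θ : Pt ≃ Pt, (∀ n j, θ (n + m, j) = ((θ (n, j)).1 + l, (θ (n, j)).2)) ∧
      (∀ z, Colored (θ z) ↔ Colored z) ∧
      θ ((a : ℤ), ((E, ∅) : Orb)) = ((b : ℤ), ((E', ∅) : Orb)) := by
  have : NeZero m := ⟨by omega⟩
  have : NeZero l := ⟨by omega⟩
  obtain ⟨σ, hσ, hσx⟩ := exists_trace_equiv m l (by omega) (by omega) (⟨a, ha⟩, (E, ∅))
    (⟨b, hb⟩, (E', ∅)) (Set.ext fun k => h k)
  let d : ∀ (r : ℕ) [NeZero r], ℤ × (Fin r × Orb) ≃ Pt := fun r _ =>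
    (Equiv.prodAssoc _ _ _).symm.trans (Equiv.prodCongr (Int.divModEquiv r).symm (Equiv.refl _))
  have hd : ∀ (r : ℕ) [NeZero r] k (i : Fin r) j, d r (k, (i, j)) = (k * r + (i : ℤ), j) := by
    intros; rfl
  let θ : Pt ≃ Pt := (d m).symm.trans ((Equiv.prodCongr (Equiv.refl ℤ) σ).trans (d l))
  have hθ : ∀ k x, θ (d m (k, x)) = d l (k, σ x) := by simp [θ]
  refine ⟨θ, fun n j => ?_, fun z => ?_, ?_⟩
  · obtain ⟨⟨k, i, j'⟩, hz⟩ := (d m).surjective (n, j)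
    have h1 : (n + (m : ℤ), j) = d m (k + 1, (i, j')) := by
      rw [hd] at hz ⊢
      simp only [Prod.mk.injEq] at hz ⊢
      exact ⟨by rw [← hz.1]; ring, hz.2.symm⟩
    rw [h1, ← hz, hθ, hθ]
    obtain ⟨i', j''⟩ := σ (i, j')
    rw [hd, hd]
    ext1
    · dsimp only; ring
    · rfl
  · obtain ⟨⟨k, x⟩, rfl⟩ := (d m).surjective z
    rw [hθ]
    exact Set.ext_iff.1 (hσ x) k
  · have h1 : ((a : ℤ), ((E, ∅) : Orb)) = d m (0, (⟨a, ha⟩, (E, ∅))) := by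
      rw [hd]; simp
    rw [h1, hθ, hσx, hd]
    simp

/-- Programs for register machines. -/
inductive Prog : Type
  | inc (r : ℕ)
  | dec (r : ℕ)
  | seq (P Q : Prog)
  | loop (r : ℕ) (P : Prog)

/-- A strict bound for the registers that a program mentions. -/
def Prog.bound : Prog → ℕ
  | .inc r => r + 1
  | .dec r => r + 1
  | .seq P Q => max P.bound Q.bound
  | .loop r P => max (r + 1) P.bound

/-- An interpretation of the registers on a type of states: `inc r s t` says that incrementing
register `r` leads from `s` to `t`, and `zero r s` that register `r` is empty. -/
structure Machine (S : Type) where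
  inc : ℕ → S → S → Prop
  zero : ℕ → S → Prop

/-- Weakest preconditions: `M.wp P X` is the set of states from which `P` terminates in `X`.
Decrementing an empty register gets stuck. -/
def Machine.wp {S : Type} (M : Machine S) : Prog → Set S → Set S
  | .inc r, X => {s | ∃ t ∈ X, M.inc r s t}
  | .dec r, X => {s | ∃ t ∈ X, M.inc r t s}
  | .seq P Q, X => M.wp P (M.wp Q X)
  | .loop r P, X => ⋂₀ {Y | ∀ s, (M.zero r s ∧ s ∈ X ∨ ¬ M.zero r s ∧ s ∈ M.wp P Y) → s ∈ Y}

theorem Machine.wp_mono {S : Type} (M : Machine S) (P : Prog) : Monotone (M.wp P) := by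
  induction P with
  | inc r => rintro X Y h s ⟨t, ht, hs⟩; exact ⟨t, h ht, hs⟩
  | dec r => rintro X Y h s ⟨t, ht, hs⟩; exact ⟨t, h ht, hs⟩
  | seq P Q hP hQ => exact fun X Y h => hP (hQ h)
  | loop r P hP =>
    intro X Y h s hs T hT
    exact hs T fun s' hs' => hT s' (hs'.imp (And.imp_right fun a => h a) id)

theorem Machine.mem_wp_loop {S : Type} (M : Machine S) (r : ℕ) (P : Prog) (X : Set S) (s : S) :
    s ∈ M.wp (.loop r P) X ↔
      M.zero r s ∧ s ∈ X ∨ ¬ M.zero r s ∧ s ∈ M.wp P (M.wp (.loop r P) X) := by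
  have key : ∀ s, (M.zero r s ∧ s ∈ X ∨ ¬ M.zero r s ∧ s ∈ M.wp P (M.wp (.loop r P) X)) →
      s ∈ M.wp (.loop r P) X := fun s hs Y hY =>
    hY s (hs.imp id (And.imp_right fun h =>
      M.wp_mono P (fun t (ht : t ∈ M.wp (.loop r P) X) => ht Y hY) h))
  refine ⟨fun h => ?_, key s⟩
  exact h {s | M.zero r s ∧ s ∈ X ∨ ¬ M.zero r s ∧ s ∈ M.wp P (M.wp (.loop r P) X)}
    fun s' hs' => hs'.imp id (And.imp_right fun h => M.wp_mono P key h)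

/-- The usual interpretation of the registers. -/
def regs : Machine (ℕ → ℕ) where
  inc r s t := t = Function.update s r (s r + 1)
  zero r s := s r = 0

/-- The interpretation of the registers by divisibility by primes. -/
noncomputable def primes : Machine ℤ where
  inc r n n' := n' = n * (Nat.nth Nat.Prime r : ℕ)
  zero r n := ¬ ((Nat.nth Nat.Prime r : ℕ) : ℤ) ∣ n

/-- The Gödel number of the first `d` registers. -/
noncomputable def goedel (d : ℕ) (s : ℕ → ℕ) : ℕ := ∏ r ∈ Finset.range d, Nat.nth Nat.Prime r ^ s r

theorem goedel_update (d r : ℕ) (hr : r < d) (s : ℕ → ℕ) :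
    goedel d (Function.update s r (s r + 1)) = goedel d s * Nat.nth Nat.Prime r := by
  have hr' : r ∈ Finset.range d := Finset.mem_range.2 hr
  unfold goedel
  rw [← Finset.mul_prod_erase _ _ hr', ← Finset.mul_prod_erase _ (fun x => _ ^ s x) hr',
    Function.update_self]
  have : ∀ x ∈ (Finset.range d).erase r,
      Nat.nth Nat.Prime x ^ Function.update s r (s r + 1) x = Nat.nth Nat.Prime x ^ s x := by
    intro x hx
    rw [Function.update_of_ne (Finset.ne_of_mem_erase hx)]
  rw [Finset.prod_congr rfl this]
  ring

theorem nth_prime_dvd_goedel (d r : ℕ) (hr : r < d) (s : ℕ → ℕ) :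
    Nat.nth Nat.Prime r ∣ goedel d s ↔ s r ≠ 0 := by
  have hp := fun x => Nat.prime_nth_prime x
  refine ⟨fun h h0 => ?_, fun h => ?_⟩
  · obtain ⟨x, hx, hd⟩ := (hp r).prime.exists_mem_finset_dvd h
    have := (Nat.prime_dvd_prime_iff_eq (hp r) (hp x)).1 ((hp r).dvd_of_dvd_pow hd)
    obtain rfl := Nat.nth_injective Nat.infinite_setOfPred_prime this
    rw [h0, pow_zero, Nat.dvd_one] at hd
    exact (hp r).one_lt.ne' hd
  · exact (dvd_pow_self _ h).trans (Finset.dvd_prod_of_mem (fun x => Nat.nth Nat.Prime x ^ s x)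
      (Finset.mem_range.2 hr))

theorem goedel_mem_wp (d : ℕ) (P : Prog) (hP : P.bound ≤ d) (X : Set ℤ) (s : ℕ → ℕ) :
    (goedel d s : ℤ) ∈ primes.wp P X ↔ s ∈ regs.wp P {t | (goedel d t : ℤ) ∈ X} := by
  induction P generalizing X s with
  | inc r =>
    have e : ((goedel d (Function.update s r (s r + 1)) : ℕ) : ℤ) =
        goedel d s * (Nat.nth Nat.Prime r : ℕ) := by
      rw [goedel_update d r hP]; push_cast; rfl
    constructor
    · rintro ⟨_, h, rfl⟩
      exact ⟨_, by rwa [Set.mem_ofPred, e], rfl⟩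
    · rintro ⟨_, h, rfl⟩
      exact ⟨_, h, e⟩
  | dec r =>
    have hp : ((Nat.nth Nat.Prime r : ℕ) : ℤ) ≠ 0 := by
      exact_mod_cast (Nat.prime_nth_prime r).ne_zero
    constructor
    · rintro ⟨n, h, hn⟩
      have h0 : s r ≠ 0 := by
        rw [← nth_prime_dvd_goedel d r hP s, ← Int.natCast_dvd_natCast, hn]
        exact dvd_mul_left _ _
      have hs : s = Function.update (Function.update s r (s r - 1)) r
          ((Function.update s r (s r - 1)) r + 1) := by
        simp [Nat.sub_add_cancel (Nat.pos_of_ne_zero h0)]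
      refine ⟨_, ?_, hs⟩
      rw [hs, goedel_update d r hP] at hn
      push_cast at hn
      rw [Set.mem_ofPred, mul_right_cancel₀ hp hn]
      exact h
    · rintro ⟨t, h, rfl⟩
      refine ⟨_, h, ?_⟩
      rw [goedel_update d r hP]; push_cast; rfl
  | seq P Q ihP ihQ =>
    simp only [Prog.bound, max_le_iff] at hP
    simp only [Machine.wp, ihP hP.1, ihQ hP.2, Set.ofPred_mem_eq]
  | loop r P ih =>
    simp only [Prog.bound, max_le_iff] at hP
    have hz : ∀ s, primes.zero r (goedel d s : ℤ) ↔ regs.zero r s := fun s => by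
      simp only [primes, regs, Int.natCast_dvd_natCast, nth_prime_dvd_goedel d r hP.1]
      simp
    constructor
    · intro h
      have hT : {t | (goedel d t : ℤ) ∈ {n | ∀ s, n = (goedel d s : ℤ) →
          s ∈ regs.wp (.loop r P) {t | (goedel d t : ℤ) ∈ X}}} ⊆
          regs.wp (.loop r P) {t | (goedel d t : ℤ) ∈ X} := fun t ht => ht t rfl
      refine h {n | ∀ s, n = (goedel d s : ℤ) →
        s ∈ regs.wp (.loop r P) {t | (goedel d t : ℤ) ∈ X}} ?_ s rfl
      rintro _ hn s rfl
      rw [hz, ih hP.2] at hn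
      rw [Machine.mem_wp_loop]
      exact hn.imp id (And.imp_right fun h => regs.wp_mono P hT h)
    · intro h
      refine h {s | (goedel d s : ℤ) ∈ primes.wp (.loop r P) X} ?_
      intro s hs
      rw [Set.mem_ofPred, Machine.mem_wp_loop, hz, ih hP.2]
      exact hs

/-- A rewriting rule on pairs consisting of a label and an integer: for every integer `k`,
`(src, k * m + a)` is related to `(tgt, k * l + b)`. -/
structure Rule (L : Type) where
  src : L
  tgt : L
  m : ℕ
  a : ℕ
  l : ℕ
  b : ℕ

/-- The rewriting rules associated with a program followed by a list of programs. -/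
noncomputable def rules : Prog → List Prog → List (Rule (List Prog))
  | .inc r, R => [⟨.inc r :: R, R, 1, 0, Nat.nth Nat.Prime r, 0⟩]
  | .dec r, R => [⟨.dec r :: R, R, Nat.nth Nat.Prime r, 0, 1, 0⟩]
  | .seq P Q, R => ⟨.seq P Q :: R, P :: Q :: R, 1, 0, 1, 0⟩ :: (rules P (Q :: R) ++ rules Q R)
  | .loop r P, R => ⟨.loop r P :: R, P :: .loop r P :: R, Nat.nth Nat.Prime r, 0,
      Nat.nth Nat.Prime r, 0⟩ :: (rules P (.loop r P :: R) ++
      (List.range (Nat.nth Nat.Prime r - 1)).map fun a =>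
        ⟨.loop r P :: R, R, Nat.nth Nat.Prime r, a + 1, Nat.nth Nat.Prime r, a + 1⟩)

theorem rules_spec (P : Prog) (R : List Prog) : ∀ ρ ∈ rules P R,
    ρ.src ≠ ρ.tgt ∧ ρ.a < ρ.m ∧ ρ.b < ρ.l := by
  have hp := fun r => (Nat.prime_nth_prime r).pos
  induction P generalizing R with
  | inc r => simp [rules, hp]
  | dec r => simp [rules, hp]
  | seq P Q hP hQ =>
    simp only [rules, List.mem_cons, List.mem_append]
    rintro ρ (rfl | h | h)
    · refine ⟨fun h => ?_, by simp, by simp⟩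
      simpa using congrArg List.length h
    · exact hP _ _ h
    · exact hQ _ _ h
  | loop r P hP =>
    simp only [rules, List.mem_cons, List.mem_append, List.mem_map, List.mem_range]
    rintro ρ (rfl | h | ⟨a, ha, rfl⟩)
    · refine ⟨fun h => ?_, hp r, hp r⟩
      simpa using congrArg List.length h
    · exact hP _ _ h
    · exact ⟨by simp, by dsimp only; omega, by dsimp only; omega⟩

/-- The integers from which the given programs, executed one after the other, end in `1`. -/
def accepted (R : List Prog) : Set ℤ := R.foldr primes.wp {1}

theorem accepted_iff_of_mem_rules (P : Prog) (R : List Prog) : ∀ ρ ∈ rules P R, ∀ k : ℤ,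
    k * ρ.m + ρ.a ∈ accepted ρ.src ↔ k * ρ.l + ρ.b ∈ accepted ρ.tgt := by
  have hp : ∀ r, Nat.nth Nat.Prime r ≠ 0 := fun r => (Nat.prime_nth_prime r).ne_zero
  induction P generalizing R with
  | inc r => simp [rules, accepted, Machine.wp, primes]
  | dec r => simp [rules, accepted, Machine.wp, primes, hp]
  | seq P Q hP hQ =>
    simp only [rules, List.mem_cons, List.mem_append]
    rintro ρ (rfl | h | h)
    · simp [accepted, Machine.wp]
    · exact hP _ _ h
    · exact hQ _ _ h
  | loop r P hP =>
    simp only [rules, List.mem_cons, List.mem_append, List.mem_map, List.mem_range]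
    rintro ρ (rfl | h | ⟨a, ha, rfl⟩)
    · intro k
      simp only [accepted, List.foldr_cons]
      rw [Machine.mem_wp_loop]
      simp [primes]
    · exact hP _ _ h
    · intro k
      simp only [accepted, List.foldr_cons]
      rw [Machine.mem_wp_loop]
      have : ¬ ((Nat.nth Nat.Prime r : ℕ) : ℤ) ∣ k * (Nat.nth Nat.Prime r : ℕ) + (a + 1 : ℕ) := by
        rw [Int.dvd_add_right (dvd_mul_left _ _), Int.natCast_dvd_natCast]
        exact fun h => absurd (Nat.le_of_dvd (by omega) h) (by omega)
      simp [primes] at this ⊢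
      simp [this]

/-- A set of pairs is closed if the inverses of the given rules do not lead out of it. -/
def Closed {L : Type} (rs : Set (Rule L)) (X : L → Set ℤ) : Prop :=
  ∀ ρ ∈ rs, ∀ k : ℤ, k * ρ.l + ρ.b ∈ X ρ.tgt → k * ρ.m + ρ.a ∈ X ρ.src

theorem wp_subset_of_closed (P : Prog) (R : List Prog) (X : List Prog → Set ℤ)
    (hX : Closed {ρ | ρ ∈ rules P R} X) : primes.wp P (X R) ⊆ X (P :: R) := by
  have hp : ∀ r, 0 < Nat.nth Nat.Prime r := fun r => (Nat.prime_nth_prime r).pos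
  induction P generalizing R with
  | inc r =>
    rintro n ⟨_, h, rfl⟩
    simpa using hX _ (List.mem_singleton_self _) n (by simpa using h)
  | dec r =>
    rintro _ ⟨n, h, rfl⟩
    simpa using hX _ (List.mem_singleton_self _) n (by simpa using h)
  | seq P Q hP hQ =>
    intro n hn
    have h1 := hQ R (fun ρ hρ => hX ρ (by simp [rules, Set.mem_ofPred.1 hρ]))
    have h2 := hP (Q :: R) (fun ρ hρ => hX ρ (by simp [rules, Set.mem_ofPred.1 hρ]))
    have h3 := h2 (primes.wp_mono P h1 hn)
    simpa using hX _ List.mem_cons_self n (by simpa using h3)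
  | loop r P hP =>
    intro n hn
    refine hn (X (.loop r P :: R)) ?_
    have h1 := hP (.loop r P :: R) (fun ρ hρ => hX ρ (by simp [rules, Set.mem_ofPred.1 hρ]))
    rintro n (⟨hz, hn⟩ | ⟨hz, hn⟩)
    · simp only [primes] at hz
      have hlt := Int.emod_lt_of_pos n
        (by exact_mod_cast hp r : (0 : ℤ) < (Nat.nth Nat.Prime r : ℕ))
      have hnn := Int.emod_nonneg n (by exact_mod_cast (hp r).ne' :
        ((Nat.nth Nat.Prime r : ℕ) : ℤ) ≠ 0)
      rw [Int.dvd_iff_emod_eq_zero] at hz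
      obtain ⟨a, ha⟩ : ∃ a : ℕ, n % (Nat.nth Nat.Prime r : ℕ) = (a + 1 : ℕ) :=
        ⟨(n % (Nat.nth Nat.Prime r : ℕ)).toNat - 1, by omega⟩
      have e : n / (Nat.nth Nat.Prime r : ℕ) * (Nat.nth Nat.Prime r : ℕ) + (a + 1 : ℕ) = n := by
        rw [← ha, Int.ediv_mul_add_emod]
      have := hX ⟨.loop r P :: R, R, Nat.nth Nat.Prime r, a + 1, Nat.nth Nat.Prime r, a + 1⟩
        (List.mem_cons_of_mem _ (List.mem_append_right _ (List.mem_map.2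
          ⟨a, List.mem_range.2 (by omega), rfl⟩))) (n / (Nat.nth Nat.Prime r : ℕ))
      simp only [e] at this
      exact this hn
    · simp only [primes, not_not] at hz
      obtain ⟨k, rfl⟩ := hz
      have := hX _ List.mem_cons_self k
      simp only [Nat.cast_zero, add_zero, mul_comm k] at this
      exact this (h1 hn)

open scoped commutatorElement

section Wreath

variable {Y : Type}

/-- The unrestricted wreath product of the symmetric group on four letters by `Equiv.Perm Y`. -/
abbrev Wreath (Y : Type) : Type :=
  (Y → Equiv.Perm (Fin 4)) ⋊[mulAutArrow (G := Equiv.Perm Y)] Equiv.Perm Y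

/-- An involution without fixed points. -/
def pointPerm : Equiv.Perm (Fin 4) := Equiv.swap 0 1 * Equiv.swap 2 3

/-- An involution that does not commute with `pointPerm`. -/
def colorPerm : Equiv.Perm (Fin 4) := Equiv.swap 0 2

/-- The element of the wreath product supported at a point. -/
noncomputable def point (y : Y) : Wreath Y :=
  open Classical in SemidirectProduct.inl (Pi.mulSingle y pointPerm)

/-- The element of the wreath product supported off the set `C`. -/
noncomputable def color (C : Set Y) : Wreath Y :=
  open Classical in SemidirectProduct.inl fun y => if y ∈ C then 1 else colorPerm

/-- A permutation as an element of the wreath product. -/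
def perm (π : Equiv.Perm Y) : Wreath Y := SemidirectProduct.inr π

theorem perm_conj_point (π : Equiv.Perm Y) (y : Y) :
    perm π * point y * (perm π)⁻¹ = point (π y) := by
  classical
  rw [perm, point, ← map_inv, ← SemidirectProduct.inl_aut, point]
  congr 1
  ext1 z
  change (Pi.mulSingle y pointPerm : Y → Equiv.Perm (Fin 4)) (π⁻¹ z) = _
  rw [Pi.mulSingle_apply, Pi.mulSingle_apply, Equiv.Perm.inv_eq_iff_eq]

theorem color_commute_perm (C : Set Y) (π : Equiv.Perm Y) (h : ∀ y, π y ∈ C ↔ y ∈ C) :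
    Commute (color C) (perm π) := by
  classical
  refine Commute.symm (mul_inv_eq_iff_eq_mul.1 ?_)
  rw [perm, color, ← map_inv, ← SemidirectProduct.inl_aut]
  congr 1
  ext1 z
  change (if π⁻¹ z ∈ C then (1 : Equiv.Perm (Fin 4)) else colorPerm) = _
  have := h (π⁻¹ z)
  rw [← Equiv.Perm.mul_apply, mul_inv_cancel, Equiv.Perm.one_apply] at this
  simp only [this]

theorem color_commute_point (C : Set Y) (y : Y) (h : y ∈ C) :
    Commute (color C) (point y) := by
  classical
  refine Commute.map (?_ : Commute _ _) SemidirectProduct.inl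
  refine Pi.commute_iff.2 fun z => ?_
  by_cases hz : z = y
  · simp [hz, h]
  · simp [hz]

theorem commutator_color_point (C : Set Y) (y : Y) (h : y ∉ C) :
    ⁅color C, point y⁆ * ⁅color C, point y⁆ = 1 ∧ ⁅color C, point y⁆ ≠ 1 := by
  classical
  have key : ⁅color C, point y⁆ =
      SemidirectProduct.inl (Pi.mulSingle y ⁅colorPerm, pointPerm⁆ : Y → Equiv.Perm (Fin 4)) := by
    rw [color, point, ← map_commutatorElement]
    congr 1
    ext1 z
    by_cases hz : z = y
    · subst hz; simp [commutatorElement_def, h]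
    · simp [hz, commutatorElement_def]
  have h1 : ⁅colorPerm, pointPerm⁆ * ⁅colorPerm, pointPerm⁆ = 1 := by decide
  have h2 : ⁅colorPerm, pointPerm⁆ ≠ 1 := by decide
  rw [key]
  constructor
  · rw [← map_mul, ← Pi.mulSingle_mul, h1, Pi.mulSingle_one, map_one]
  · rw [Ne, ← map_one SemidirectProduct.inl, SemidirectProduct.inl_inj, Pi.mulSingle_eq_one_iff]
    exact h2

theorem point_involution (y : Y) : point y * point y = 1 ∧ point y ≠ 1 := by
  classical
  have h1 : pointPerm * pointPerm = 1 := by decide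
  have h2 : pointPerm ≠ 1 := by decide
  constructor
  · rw [point, ← map_mul, ← Pi.mulSingle_mul, h1, Pi.mulSingle_one, map_one]
  · rw [point, Ne, ← map_one SemidirectProduct.inl, SemidirectProduct.inl_inj,
      Pi.mulSingle_eq_one_iff]
    exact h2

theorem color_involution (C : Set Y) (y : Y) (h : y ∉ C) :
    color C * color C = 1 ∧ color C ≠ 1 := by
  classical
  have h1 : colorPerm * colorPerm = 1 := by decide
  have h2 : colorPerm ≠ 1 := by decide
  constructor
  · rw [color, ← map_mul, ← map_one SemidirectProduct.inl]
    congr 1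
    ext1 z
    by_cases hz : z ∈ C <;> simp [hz, h1]
  · rw [color, Ne, ← map_one SemidirectProduct.inl, SemidirectProduct.inl_inj]
    intro h3
    have := congrFun h3 y
    rw [if_neg h] at this
    exact h2 this

theorem perm_involution (π : Equiv.Perm Y) (h : ∀ y, π (π y) = y) (y : Y) (hy : π y ≠ y) :
    perm π * perm π = 1 ∧ perm π ≠ 1 := by
  constructor
  · rw [perm, ← map_mul, ← map_one SemidirectProduct.inr]
    congr 1
    exact Equiv.ext h
  · rw [perm, Ne, ← map_one SemidirectProduct.inr, SemidirectProduct.inr_inj]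
    rintro rfl
    exact hy rfl

end Wreath

section Sheets

variable {Q : Type}

open Classical in
/-- The reflection `n ↦ c - n` on the sheet `q` of `Q × Pt`. -/
noncomputable def reflect (q : Q) (c : ℤ) : Equiv.Perm (Q × Pt) :=
  Function.Involutive.toPerm (fun y => if y.1 = q then (y.1, (c - y.2.1, y.2.2)) else y) (by
    rintro ⟨q', n, j⟩
    by_cases h : q' = q <;> simp [h])

open Classical in
theorem reflect_apply (q : Q) (c : ℤ) (y : Q × Pt) :
    reflect q c y = if y.1 = q then (y.1, (c - y.2.1, y.2.2)) else y := rfl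

open Classical in
theorem reflect_mul_reflect_pow (q : Q) (c : ℕ) (y : Q × Pt) :
    ((reflect q 1 * reflect q 0) ^ c) y = if y.1 = q then (y.1, (y.2.1 + c, y.2.2)) else y := by
  induction c with
  | zero => simp
  | succ c ih =>
    rw [pow_succ', Equiv.Perm.mul_apply, ih]
    obtain ⟨q', n, j⟩ := y
    by_cases h : q' = q
    · simp [reflect_apply, h]
      ring
    · simp [reflect_apply, h]

open Classical in
/-- The permutation of `Q × Pt` swapping two sheets by means of an equivalence. -/
noncomputable def swapSheets (q q' : Q) (h : q ≠ q') (θ : Pt ≃ Pt) : Equiv.Perm (Q × Pt) :=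
  Function.Involutive.toPerm (fun y => if y.1 = q then (q', θ y.2) else
    if y.1 = q' then (q, θ.symm y.2) else y) (by
    rintro ⟨p, z⟩
    by_cases h1 : p = q
    · simp [h1, h.symm]
    · by_cases h2 : p = q'
      · simp [h2, h.symm]
      · simp [h1, h2])

open Classical in
theorem swapSheets_apply {q q' : Q} (h : q ≠ q') (θ : Pt ≃ Pt) (y : Q × Pt) :
    swapSheets q q' h θ y = if y.1 = q then (q', θ y.2) else
      if y.1 = q' then (q, θ.symm y.2) else y := rfl

theorem swapSheets_left {q q' : Q} (h : q ≠ q') (θ : Pt ≃ Pt) (z : Pt) :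
    swapSheets q q' h θ (q, z) = (q', θ z) := by simp [swapSheets_apply]

theorem swapSheets_colored {q q' : Q} (h : q ≠ q') (θ : Pt ≃ Pt)
    (hθ : ∀ z, Colored (θ z) ↔ Colored z) (y : Q × Pt) :
    Colored (swapSheets q q' h θ y).2 ↔ Colored y.2 := by
  obtain ⟨p, z⟩ := y
  by_cases h1 : p = q
  · simp [swapSheets_apply, h1, hθ]
  · by_cases h2 : p = q'
    · simpa [swapSheets_apply, h2, h.symm] using (hθ (θ.symm z)).symm
    · simp [swapSheets_apply, h1, h2]

theorem swapSheets_conj {q q' : Q} (h : q ≠ q') (θ : Pt ≃ Pt) (m l : ℕ)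
    (hθ : ∀ n j, θ (n + m, j) = ((θ (n, j)).1 + l, (θ (n, j)).2)) :
    swapSheets q q' h θ * (reflect q 1 * reflect q 0) ^ m * (swapSheets q q' h θ)⁻¹ =
      (reflect q' 1 * reflect q' 0) ^ l := by
  rw [mul_inv_eq_iff_eq_mul]
  ext1 ⟨p, n, j⟩
  simp only [Equiv.Perm.mul_apply, reflect_mul_reflect_pow]
  by_cases h1 : p = q
  · simp [swapSheets_apply, h1, hθ]
  · by_cases h2 : p = q'
    · simp [swapSheets_apply, h2, h.symm, h]
    · simp [swapSheets_apply, h1, h2]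

end Sheets

section Presentation

variable {Q ι : Type}

/-- The generators represented by involutions. -/
inductive Invol (Q ι : Type) : Type
  | sigma (q : Q)
  | tau (q : Q)
  | point (q : Q)
  | swap (i : ι)
  | color

/-- The generators of the presentation associated with a system of rules. -/
inductive Gen (Q ι : Type) : Type
  | inv (s : Invol Q ι)
  | shift (q : Q)
  | center
  | witness
  | link (o : Option (Invol Q ι))

/-- The conjugate of `t` by `x ^ n`. -/
def shifted {G : Type} [Group G] (x t : G) (n : ℕ) : G := x ^ n * t * (x ^ n)⁻¹

theorem map_shifted {G H : Type} [Group G] [Group H] (φ : G →* H) (x t : G) (n : ℕ) :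
    φ (shifted x t n) = shifted (φ x) (φ t) n := by simp [shifted]

/-- The relations associated with a system of rules and a final label `f`. -/
structure Satisfies (rule : ι → Rule Q) (f : Q) {G : Type} [Group G] (g : Gen Q ι → G) : Prop where
  shift_eq : ∀ q, g (.shift q) = g (.inv (.tau q)) * g (.inv (.sigma q))
  swap_shift : ∀ i, g (.inv (.swap i)) * g (.shift (rule i).src) ^ (rule i).m *
    (g (.inv (.swap i)))⁻¹ = g (.shift (rule i).tgt) ^ (rule i).l
  swap_point : ∀ i, g (.inv (.swap i)) *
    shifted (g (.shift (rule i).src)) (g (.inv (.point (rule i).src))) (rule i).a *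
    (g (.inv (.swap i)))⁻¹ =
      shifted (g (.shift (rule i).tgt)) (g (.inv (.point (rule i).tgt))) (rule i).b
  color_swap : ∀ i, Commute (g (.inv .color)) (g (.inv (.swap i)))
  color_point : Commute (g (.inv .color)) (shifted (g (.shift f)) (g (.inv (.point f))) 1)
  link_witness : Links (g .witness) (g (.link none)) (g .center)
  link_center : ∀ s, Links (g .center) (g (.link (some s))) (g (.inv s))

/-- The value of the generator `witness` prescribed by the relator depending on the input. -/
def witnessWord (q₀ : Q) (n : ℕ) {G : Type} [Group G] (g : Gen Q ι → G) : G :=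
  ⁅g (.inv .color), shifted (g (.shift q₀)) (g (.inv (.point q₀))) n⁆

theorem Satisfies.eq_one {rule : ι → Rule Q} {f : Q} {G : Type} [Group G] {g : Gen Q ι → G}
    (h : Satisfies rule f g) (q₀ : Q) (n : ℕ) (hw : g .witness = witnessWord q₀ n g)
    (hn : ∀ X : Q → Set ℤ, Closed (Set.range rule) X → 1 ∈ X f → (n : ℤ) ∈ X q₀) (x : Gen Q ι) :
    g x = 1 := by
  have key := hn (fun q => {c | Commute (g (.inv .color))
    (g (.shift q) ^ c * g (.inv (.point q)) * (g (.shift q) ^ c)⁻¹)}) (by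
      rintro _ ⟨i, rfl⟩ k (hk : Commute _ _)
      change Commute _ _
      have hc := h.color_swap i
      have e : g (.inv (.swap i)) * (g (.shift (rule i).src) ^ (k * (rule i).m + (rule i).a) *
          g (.inv (.point (rule i).src)) *
          (g (.shift (rule i).src) ^ (k * (rule i).m + (rule i).a))⁻¹) *
          (g (.inv (.swap i)))⁻¹ = (g (.shift (rule i).tgt) ^ (k * (rule i).l + (rule i).b) *
          g (.inv (.point (rule i).tgt)) *
          (g (.shift (rule i).tgt) ^ (k * (rule i).l + (rule i).b))⁻¹) := by
        have h1 := h.swap_shift i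
        have h2 := h.swap_point i
        set ρ := g (.inv (.swap i))
        set x := g (.shift (rule i).src)
        set x' := g (.shift (rule i).tgt)
        unfold shifted at h2
        have h3 : ρ * x ^ (k * (rule i).m : ℤ) * ρ⁻¹ = x' ^ (k * (rule i).l : ℤ) := by
          rw [mul_comm k, mul_comm k, zpow_mul, zpow_mul, ← conj_zpow, zpow_natCast, zpow_natCast,
            h1]
        rw [zpow_add, zpow_add, ← h3, zpow_natCast, zpow_natCast]
        calc _ = (ρ * x ^ (k * (rule i).m : ℤ) * ρ⁻¹) * (ρ * (x ^ (rule i).a *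
            g (.inv (.point (rule i).src)) * (x ^ (rule i).a)⁻¹) * ρ⁻¹) *
            (ρ * x ^ (k * (rule i).m : ℤ) * ρ⁻¹)⁻¹ := by group
          _ = _ := by rw [h2]; group
      rw [← e] at hk
      have := (hc.inv_right.mul_right hk).mul_right hc
      simpa [mul_assoc] using this) (by
      have := h.color_point
      simpa [shifted] using this)
  have hw1 : g .witness = 1 := by
    rw [hw, witnessWord, commutatorElement_eq_one_iff_commute]
    simpa [shifted] using key
  obtain ⟨hl, hv⟩ := h.link_witness.eq_one hw1
  have hs := fun s => (h.link_center s).eq_one hv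
  match x with
  | .inv s => exact (hs s).2
  | .shift q => rw [h.shift_eq, (hs _).2, (hs _).2, one_mul]
  | .center => exact hv
  | .witness => exact hw1
  | .link none => exact hl
  | .link (some s) => exact (hs s).1

end Presentation

section Nontrivial

variable {Q ι : Type}

/-- A set of labelled integers that is invariant under the rules yields a solution of all relations
except those involving links. -/
theorem exists_involutions (rule : ι → Rule Q) (f : Q)
    (hrule : ∀ i, (rule i).src ≠ (rule i).tgt ∧ (rule i).a < (rule i).m ∧ (rule i).b < (rule i).l)
    (D : Q → Set ℤ) (hD : ∀ i, ∀ k : ℤ, k * (rule i).m + (rule i).a ∈ D (rule i).src ↔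
      k * (rule i).l + (rule i).b ∈ D (rule i).tgt) (hf : 1 ∈ D f) (q₀ : Q) (n : ℕ)
    (hn : (n : ℤ) ∉ D q₀) :
    ∃ (G : Type) (_ : Group G) (s : Invol Q ι → G) (x : Q → G),
      (∀ i, s i * s i = 1 ∧ s i ≠ 1) ∧
      (∀ q, x q = s (.tau q) * s (.sigma q)) ∧
      (∀ i, s (.swap i) * x (rule i).src ^ (rule i).m * (s (.swap i))⁻¹ =
        x (rule i).tgt ^ (rule i).l) ∧
      (∀ i, s (.swap i) * shifted (x (rule i).src) (s (.point (rule i).src)) (rule i).a *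
        (s (.swap i))⁻¹ = shifted (x (rule i).tgt) (s (.point (rule i).tgt)) (rule i).b) ∧
      (∀ i, Commute (s .color) (s (.swap i))) ∧
      Commute (s .color) (shifted (x f) (s (.point f)) 1) ∧
      ⁅s .color, shifted (x q₀) (s (.point q₀)) n⁆ *
        ⁅s .color, shifted (x q₀) (s (.point q₀)) n⁆ = 1 ∧
      ⁅s .color, shifted (x q₀) (s (.point q₀)) n⁆ ≠ 1 := by
  classical
  choose θ hθ hθc hθb using fun i => exists_shift_equiv (rule i).m (rule i).l (rule i).a (rule i).b
    (hrule i).2.1 (hrule i).2.2 (D (rule i).src) (D (rule i).tgt) (hD i)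
  let base : Q → ℕ → Q × Pt := fun q c => (q, ((c : ℤ), ((D q, ∅) : Orb)))
  let C : Set (Q × Pt) := {y | Colored y.2}
  have hC : ∀ q c, base q c ∈ C ↔ (c : ℤ) ∈ D q := fun q c => Iff.rfl
  let ρ : ι → Equiv.Perm (Q × Pt) := fun i =>
    swapSheets (rule i).src (rule i).tgt (hrule i).1 (θ i)
  let s : Invol Q ι → Wreath (Q × Pt) := fun
    | .sigma q => perm (reflect q 0)
    | .tau q => perm (reflect q 1)
    | .point q => point (base q 0)
    | .swap i => perm (ρ i)
    | .color => color C
  let x : Q → Wreath (Q × Pt) := fun q => perm (reflect q 1 * reflect q 0)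
  have hx : ∀ q c, x q ^ c = perm ((reflect q 1 * reflect q 0) ^ c) := fun q c =>
    (map_pow (SemidirectProduct.inr : _ →* Wreath (Q × Pt)) _ _).symm
  have hsh : ∀ q c, shifted (x q) (s (.point q)) c = point (base q c) := by
    intro q c
    rw [shifted, hx, perm_conj_point, reflect_mul_reflect_pow]
    simp [base]
  refine ⟨Wreath (Q × Pt), inferInstance, s, x, ?_, ?_, ?_, ?_, ?_, ?_, ?_⟩
  · rintro (q | q | q | i | _)
    · exact perm_involution _ (Function.Involutive.toPerm_involutive _) (q, (2, (∅, ∅)))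
        (by simp [reflect_apply])
    · exact perm_involution _ (Function.Involutive.toPerm_involutive _) (q, (2, (∅, ∅)))
        (by simp [reflect_apply])
    · exact point_involution _
    · exact perm_involution _ (Function.Involutive.toPerm_involutive _)
        ((rule i).src, (0, (∅, ∅))) (fun h => (hrule i).1 (by
          have := congrArg Prod.fst h
          rw [swapSheets_left] at this
          exact this.symm))
    · exact color_involution _ (base q₀ n) (by rwa [hC])
  · intro q
    exact map_mul (SemidirectProduct.inr : _ →* Wreath (Q × Pt)) _ _
  · intro i
    rw [hx, hx, ← swapSheets_conj (hrule i).1 (θ i) _ _ (hθ i)]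
    simp [s, ρ, perm]
  · intro i
    rw [hsh, hsh]
    change perm (ρ i) * _ * (perm (ρ i))⁻¹ = _
    rw [perm_conj_point]
    congr 1
    change swapSheets _ _ _ _ ((rule i).src, _) = _
    rw [swapSheets_left, hθb]
  · intro i
    exact color_commute_perm _ _ (swapSheets_colored _ _ (hθc i))
  · rw [hsh]
    exact color_commute_point _ _ (by rw [hC]; exact_mod_cast hf)
  · rw [hsh]
    exact commutator_color_point _ _ (by rwa [hC])

instance [Finite Q] [Finite ι] : Finite (Invol Q ι) := by
  refine Finite.of_surjective
    (fun z : Q ⊕ Q ⊕ Q ⊕ ι ⊕ Unit => (match z with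
      | .inl q => .sigma q
      | .inr (.inl q) => .tau q
      | .inr (.inr (.inl q)) => .point q
      | .inr (.inr (.inr (.inl i))) => .swap i
      | .inr (.inr (.inr (.inr _))) => .color : Invol Q ι)) ?_
  rintro (q | q | q | i | _)
  exacts [⟨.inl q, rfl⟩, ⟨.inr (.inl q), rfl⟩, ⟨.inr (.inr (.inl q)), rfl⟩,
    ⟨.inr (.inr (.inr (.inl i))), rfl⟩, ⟨.inr (.inr (.inr (.inr ()))), rfl⟩]

instance [Finite Q] [Finite ι] : Finite (Gen Q ι) := by
  refine Finite.of_surjective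
    (fun z : Invol Q ι ⊕ Q ⊕ Bool ⊕ Option (Invol Q ι) => (match z with
      | .inl s => .inv s
      | .inr (.inl q) => .shift q
      | .inr (.inr (.inl true)) => .center
      | .inr (.inr (.inl false)) => .witness
      | .inr (.inr (.inr o)) => .link o : Gen Q ι)) ?_
  rintro (s | q | _ | _ | o)
  exacts [⟨.inl s, rfl⟩, ⟨.inr (.inl q), rfl⟩, ⟨.inr (.inr (.inl true)), rfl⟩,
    ⟨.inr (.inr (.inl false)), rfl⟩, ⟨.inr (.inr (.inr o)), rfl⟩]

theorem exists_satisfies [Finite Q] [Finite ι] (rule : ι → Rule Q) (f : Q)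
    (hrule : ∀ i, (rule i).src ≠ (rule i).tgt ∧ (rule i).a < (rule i).m ∧ (rule i).b < (rule i).l)
    (D : Q → Set ℤ) (hD : ∀ i, ∀ k : ℤ, k * (rule i).m + (rule i).a ∈ D (rule i).src ↔
      k * (rule i).l + (rule i).b ∈ D (rule i).tgt) (hf : 1 ∈ D f) (q₀ : Q) (n : ℕ)
    (hn : (n : ℤ) ∉ D q₀) :
    ∃ (G : Type) (_ : Group G) (g : Gen Q ι → G), Satisfies rule f g ∧
      g .witness = witnessWord q₀ n g ∧ g .center ≠ 1 := by
  obtain ⟨Γ, _, s, x, hs, hx, h1, h2, h3, h4, h5, h6⟩ := exists_involutions rule f hrule D hD hf q₀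
    n hn
  set w := ⁅s .color, shifted (x q₀) (s (.point q₀)) n⁆
  let _ := Fintype.ofFinite (Option (Invol Q ι))
  let j : Γ →* Γ × Multiplicative (ZMod 2) := MonoidHom.inl _ _
  let v : Γ × Multiplicative (ZMod 2) := (1, Multiplicative.ofAdd 1)
  have hj : Function.Injective j := fun a b h => congrArg Prod.fst h
  have hvv : v * v = 1 := Prod.ext (one_mul 1)
    (by decide : Multiplicative.ofAdd (1 : ZMod 2) * Multiplicative.ofAdd 1 = 1)
  have h01 : (Multiplicative.ofAdd (1 : ZMod 2)) ≠ 1 := by decide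
  have hv1 : v ≠ 1 := fun h => h01 (congrArg Prod.snd h)
  have hvj : ∀ a, j a ≠ v := fun a h => h01 (congrArg Prod.snd h).symm
  have hc : ∀ a, v * j a = j a * v := fun a => by simp [v, j]
  obtain ⟨G, _, e, y, inj, hy⟩ := exists_links (Finset.univ.toList : List (Option (Invol Q ι)))
    (fun o => o.elim (j w) fun _ => v) (fun o => o.elim v fun i => j (s i))
    (by rintro (_ | i) - <;> simp [hvv, ← map_mul, h5])
    (by rintro (_ | i) - <;> simp [hvv, ← map_mul, hs])
    (by rintro (_ | i) - <;> simp [hc])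
    (by
      rintro (_ | i) -
      · exact (map_ne_one_iff j hj).2 h6
      · exact hv1)
    (by
      rintro (_ | i) -
      · exact hv1
      · exact (map_ne_one_iff j hj).2 (hs i).2)
    (by
      rintro (_ | i) -
      · exact hvj w
      · exact (hvj (s i)).symm)
  replace hy := fun o => hy o (Finset.mem_toList.2 (Finset.mem_univ o))
  let φ : Γ →* G := e.comp j
  refine ⟨G, inferInstance, fun
    | .inv i => φ (s i)
    | .shift q => φ (x q)
    | .center => e v
    | .witness => φ w
    | .link o => y o, ?_, ?_, (map_ne_one_iff e inj).2 hv1⟩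
  · constructor
    · intro q; simp only [hx, map_mul]
    · intro i; simp only [← map_mul, ← map_pow, ← map_inv, h1]
    · intro i; simp only [← map_shifted, ← map_mul, ← map_inv, h2]
    · exact fun i => (h3 i).map φ
    · simp only [← map_shifted]; exact h4.map φ
    · exact hy none
    · exact fun i => hy (some i)
  · simp only [witnessWord, ← map_shifted, ← map_commutatorElement, w]

end Nontrivial

section Words

/-- The relators expressing `Links`. -/
def linkRelators {G : Type} [Group G] (v y s : G) : Set G :=
  {y ^ 3, (v * y) ^ 5, s * (conjWord v y * v * (conjWord v y)⁻¹)⁻¹}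

theorem forall_linkRelators {G H : Type} [Group G] [Group H] (φ : G →* H) (v y s : G) :
    (∀ r ∈ linkRelators v y s, φ r = 1) ↔ Links (φ v) (φ y) (φ s) := by
  simp only [linkRelators, Links, conjWord, Set.mem_insert_iff, Set.mem_singleton_iff,
    forall_eq_or_imp, forall_eq, map_mul, map_pow, map_inv, mul_inv_eq_one]

variable {Q ι : Type}

theorem Satisfies.exists_relators [Finite Q] [Finite ι] (rule : ι → Rule Q) (f : Q) :
    ∃ S : Set (FreeGroup (Gen Q ι)), S.Finite ∧ ∀ (G : Type) [Group G] (g : Gen Q ι → G),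
      (∀ r ∈ S, FreeGroup.lift g r = 1) ↔ Satisfies rule f g := by
  let o : Gen Q ι → FreeGroup (Gen Q ι) := FreeGroup.of
  refine ⟨Set.range (fun q => o (.shift q) * (o (.inv (.tau q)) * o (.inv (.sigma q)))⁻¹) ∪
    (Set.range (fun i => o (.inv (.swap i)) * o (.shift (rule i).src) ^ (rule i).m *
      (o (.inv (.swap i)))⁻¹ * (o (.shift (rule i).tgt) ^ (rule i).l)⁻¹) ∪
    (Set.range (fun i => o (.inv (.swap i)) *
      shifted (o (.shift (rule i).src)) (o (.inv (.point (rule i).src))) (rule i).a *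
      (o (.inv (.swap i)))⁻¹ *
      (shifted (o (.shift (rule i).tgt)) (o (.inv (.point (rule i).tgt))) (rule i).b)⁻¹) ∪
    (Set.range (fun i => ⁅o (.inv .color), o (.inv (.swap i))⁆) ∪
    ({⁅o (.inv .color), shifted (o (.shift f)) (o (.inv (.point f))) 1⁆} ∪
    (linkRelators (o .witness) (o (.link none)) (o .center) ∪
    ⋃ s, linkRelators (o .center) (o (.link (some s))) (o (.inv s))))))), ?_, ?_⟩
  · have hl : ∀ a b c : FreeGroup (Gen Q ι), (linkRelators a b c).Finite := fun a b c =>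
      ((Set.finite_singleton _).insert _).insert _
    refine (Set.finite_range _).union ((Set.finite_range _).union ((Set.finite_range _).union
      ((Set.finite_range _).union ((Set.finite_singleton _).union ((hl _ _ _).union ?_)))))
    exact Set.finite_iUnion fun s => hl _ _ _
  · intro G _ g
    have ho : ∀ x, FreeGroup.lift g (o x) = g x := fun x => FreeGroup.lift_apply_of
    simp only [Set.mem_union, or_imp, forall_and, Set.forall_mem_range, Set.mem_singleton_iff,
      forall_eq, forall_linkRelators, Set.mem_iUnion, forall_exists_index, map_mul, map_inv,
      map_pow, map_shifted, map_commutatorElement, commutatorElement_eq_one_iff_commute,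
      mul_inv_eq_one, ho]
    rw [forall_comm]
    simp only [forall_linkRelators, ho]
    constructor
    · rintro ⟨h1, h2, h3, h4, h5, h6, h7⟩
      exact ⟨h1, h2, h3, h4, h5, h6, h7⟩
    · rintro ⟨h1, h2, h3, h4, h5, h6, h7⟩
      exact ⟨h1, h2, h3, h4, h5, h6, h7⟩

theorem primrec_replicate {α : Type} [Primcodable α] (a : α) :
    Primrec fun n : ℕ => List.replicate n a := by
  refine ((Primrec.list_map Primrec.list_range ((Primrec.const a).comp
    (Primrec.snd (α := ℕ) (β := ℕ))).to₂)).of_eq fun n => ?_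
  simp

theorem primrec_two_pow : Primrec fun n : ℕ => 2 ^ n :=
  (Primrec.nat_rec' Primrec.id (Primrec.const 1)
    ((Primrec.nat_mul.comp (Primrec.snd.comp Primrec.snd) (Primrec.const 2)).to₂)).of_eq fun n => by
    induction n with
    | zero => rfl
    | succ n ih => simp only [pow_succ, ← ih]; rfl

/-- The relator defining the witness of non-acceptance. -/
def witnessRelator {m : ℕ} (w k x t : Fin m) (n : ℕ) : List (Fin m × Bool) :=
  [(w, false), (k, true)] ++ (List.replicate n (x, true) ++ ([(t, true)] ++
    (List.replicate n (x, false) ++ ([(k, false)] ++ (List.replicate n (x, true) ++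
    ([(t, false)] ++ List.replicate n (x, false)))))))

theorem primrec_witnessRelator {m : ℕ} (w k x t : Fin m) :
    Primrec fun n => witnessRelator w k x t n := by
  have h := fun b : Bool => primrec_replicate (x, b)
  unfold witnessRelator
  exact Primrec.list_append.comp (.const _) (Primrec.list_append.comp (h _)
    (Primrec.list_append.comp (.const _) (Primrec.list_append.comp (h _)
    (Primrec.list_append.comp (.const _) (Primrec.list_append.comp (h _)
    (Primrec.list_append.comp (.const _) (h _)))))))

theorem lift_witnessRelator {m : ℕ} (w k x t : Fin m) (n : ℕ) {G : Type} [Group G]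
    (g : Fin m → G) : FreeGroup.lift g (FreeGroup.mk (witnessRelator w k x t n)) = 1 ↔
      g w = ⁅g k, shifted (g x) (g t) n⁆ := by
  have : FreeGroup.lift g (FreeGroup.mk (witnessRelator w k x t n)) =
      (g w)⁻¹ * ⁅g k, shifted (g x) (g t) n⁆ := by
    simp [witnessRelator, FreeGroup.lift_mk, commutatorElement_def, shifted, mul_assoc]
  rw [this, inv_mul_eq_one]

theorem exists_presentation [Finite Q] [Finite ι] (rule : ι → Rule Q) (f q₀ : Q) :
    ∃ (m : ℕ) (e : Gen Q ι ≃ Fin m) (R : ℕ → List (List (Fin m × Bool))), Primrec R ∧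
      ∀ (n : ℕ) (G : Type) [Group G] (g : Fin m → G),
        (∀ r ∈ R n, FreeGroup.lift g (FreeGroup.mk r) = 1) ↔
          Satisfies rule f (g ∘ e) ∧ (g ∘ e) .witness = witnessWord q₀ (2 ^ n) (g ∘ e) := by
  obtain ⟨m, ⟨e⟩⟩ := Finite.exists_equiv_fin (Gen Q ι)
  obtain ⟨S, hS, h⟩ := Satisfies.exists_relators rule f
  refine ⟨m, e, fun n => witnessRelator (e .witness) (e (.inv .color)) (e (.shift q₀))
    (e (.inv (.point q₀))) (2 ^ n) :: hS.toFinset.toList.map fun r =>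
    (FreeGroup.map e r).toWord, ?_, ?_⟩
  · exact Primrec.list_cons.comp ((primrec_witnessRelator _ _ _ _).comp primrec_two_pow)
      (Primrec.const _)
  · intro n G _ g
    rw [List.forall_mem_cons, and_comm, lift_witnessRelator, ← h]
    refine and_congr ?_ Iff.rfl
    have : ∀ r, FreeGroup.lift g (FreeGroup.map e r) = FreeGroup.lift (g ∘ e) r := fun r => by
      rw [← MonoidHom.comp_apply]
      congr 1
      ext x
      simp
    simp only [List.forall_mem_map, FreeGroup.mk_toWord, this, Finset.mem_toList,
      Set.Finite.mem_toFinset]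

end Words

/-- A tuple of group elements satisfies the given words. -/
def Kills {m : ℕ} {G : Type} [Group G] (g : Fin m → G) (R : List (List (Fin m × Bool))) : Prop :=
  ∀ r ∈ R, FreeGroup.lift g (FreeGroup.mk r) = 1

theorem Prog.exists_presentation (P : Prog) :
    ∃ (m : ℕ) (R : ℕ → List (List (Fin m × Bool))), Primrec R ∧ ∀ n,
      (((2 ^ n : ℕ) : ℤ) ∈ accepted [P] →
        ∀ (G : Type) [Group G] (g : Fin m → G), Kills g (R n) → ∀ i, g i = 1) ∧
      (((2 ^ n : ℕ) : ℤ) ∉ accepted [P] →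
        ∃ (G : Type) (_ : Group G) (g : Fin m → G), Kills g (R n) ∧ ∃ i, g i ≠ 1) := by
  classical
  let rs := rules P []
  let S : Finset (List Prog) :=
    {[P], []} ∪ (rs.map Rule.src).toFinset ∪ (rs.map Rule.tgt).toFinset
  have hsrc : ∀ ρ ∈ rs, ρ.src ∈ S := fun ρ h => by
    have : ρ.src ∈ rs.map Rule.src := List.mem_map_of_mem h
    simp only [S, Finset.mem_union, List.mem_toFinset, this]
    tauto
  have htgt : ∀ ρ ∈ rs, ρ.tgt ∈ S := fun ρ h => by
    have : ρ.tgt ∈ rs.map Rule.tgt := List.mem_map_of_mem h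
    simp only [S, Finset.mem_union, List.mem_toFinset, this]
    tauto
  let rule : Fin rs.length → Rule S := fun i =>
    ⟨⟨rs[i].src, hsrc _ (List.getElem_mem _)⟩, ⟨rs[i].tgt, htgt _ (List.getElem_mem _)⟩,
      rs[i].m, rs[i].a, rs[i].l, rs[i].b⟩
  let f : S := ⟨[], by simp [S]⟩
  let q₀ : S := ⟨[P], by simp [S]⟩
  obtain ⟨m, e, R, hR, h⟩ := NontrivialGenerator.exists_presentation rule f q₀
  refine ⟨m, R, hR, fun n => ⟨fun hn G _ g hg => ?_, fun hn => ?_⟩⟩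
  · obtain ⟨hs, hw⟩ := (h n G g).1 hg
    have := hs.eq_one q₀ (2 ^ n) hw fun X hX h1 => by
      let X' : List Prog → Set ℤ := fun L => {k | ∃ h : L ∈ S, k ∈ X ⟨L, h⟩}
      have hX' : Closed {ρ | ρ ∈ rs} X' := by
        rintro ρ hρ k ⟨hS, hk⟩
        obtain ⟨i, hi, rfl⟩ := List.getElem_of_mem hρ
        exact ⟨hsrc _ hρ, hX _ ⟨⟨i, hi⟩, rfl⟩ k hk⟩
      have h2 : ({1} : Set ℤ) ⊆ X' [] := by
        rintro _ rfl
        exact ⟨f.2, h1⟩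
      obtain ⟨_, h3⟩ := wp_subset_of_closed P [] X' hX' (primes.wp_mono P h2 hn)
      exact h3
    intro i
    simpa using this (e.symm i)
  · obtain ⟨G, _, g, hs, hw, hc⟩ := exists_satisfies rule f
      (fun i => by
        obtain ⟨h1, h2⟩ := rules_spec P [] _ (List.getElem_mem i.2)
        exact ⟨fun h => h1 (congrArg Subtype.val h), h2⟩)
      (fun q => accepted q.1)
      (fun i => accepted_iff_of_mem_rules P [] _ (List.getElem_mem i.2)) rfl q₀ (2 ^ n) hn
    refine ⟨G, inferInstance, g ∘ e.symm, (h n G _).2 ?_, e .center, by simpa using hc⟩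
    have : (g ∘ e.symm) ∘ e = g := by ext; simp
    rw [this]
    exact ⟨hs, hw⟩

section Registers

open Function

/-- The program `P` leads from the state `s` to the state `t`. -/
def Runs (P : Prog) (s t : ℕ → ℕ) : Prop := ∀ X, s ∈ regs.wp P X ↔ t ∈ X

theorem Runs.of_eq {P : Prog} {s t u : ℕ → ℕ} (h : Runs P s t) (e : t = u) : Runs P s u := e ▸ h

theorem Runs.inc (r : ℕ) (s : ℕ → ℕ) : Runs (.inc r) s (update s r (s r + 1)) := by
  intro X
  constructor
  · rintro ⟨t, ht, rfl⟩; exact ht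
  · exact fun h => ⟨_, h, rfl⟩

theorem Runs.dec (r : ℕ) (s : ℕ → ℕ) : Runs (.dec r) (update s r (s r + 1)) s := by
  intro X
  constructor
  · rintro ⟨t, ht, h⟩
    have : s = t := by
      funext x
      have h1 := congrFun h x
      have h2 := congrFun h r
      simp only [update_apply] at h1 h2
      grind
    rwa [this]
  · exact fun h => ⟨_, h, rfl⟩

theorem Runs.dec' {r : ℕ} {s : ℕ → ℕ} (h : s r ≠ 0) : Runs (.dec r) s (update s r (s r - 1)) := by
  have := Runs.dec r (update s r (s r - 1))
  rw [update_self, update_idem, Nat.sub_add_cancel (Nat.pos_of_ne_zero h), update_eq_self] at this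
  exact this

theorem Runs.seq {P Q : Prog} {s t u : ℕ → ℕ} (h₁ : Runs P s t) (h₂ : Runs Q t u) :
    Runs (.seq P Q) s u := fun X => (h₁ _).trans (h₂ X)

theorem Runs.loop_zero {r : ℕ} (P : Prog) {s : ℕ → ℕ} (h : s r = 0) : Runs (.loop r P) s s := by
  intro X
  rw [Machine.mem_wp_loop]
  simp [regs, h]

theorem Runs.loop_step {r : ℕ} {P : Prog} {s t u : ℕ → ℕ} (h : s r ≠ 0) (h₁ : Runs P s t)
    (h₂ : Runs (.loop r P) t u) : Runs (.loop r P) s u := by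
  intro X
  rw [Machine.mem_wp_loop, ← h₂ X, ← h₁]
  simp [regs, h]

/-- A loop that decrements its own register once per round runs through a sequence of states. -/
theorem Runs.loop_seq {r : ℕ} {P : Prog} (s : ℕ → ℕ → ℕ) (N : ℕ) (h0 : ∀ j, s j r = N - j)
    (hs : ∀ j < N, Runs P (s j) (s (j + 1))) : Runs (.loop r P) (s 0) (s N) := by
  suffices ∀ i ≤ N, Runs (.loop r P) (s (N - i)) (s N) by simpa using this N le_rfl
  intro i hi
  induction i with
  | zero => exact Runs.loop_zero P (by simp [h0])
  | succ i ih =>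
    refine Runs.loop_step (by rw [h0]; omega) (hs _ (by omega)) ?_
    rw [show N - (i + 1) + 1 = N - i by omega]
    exact ih (by omega)

/-- Set a register to zero. -/
def clear (r : ℕ) : Prog := .loop r (.dec r)

theorem runs_clear (r : ℕ) (s : ℕ → ℕ) : Runs (clear r) s (update s r 0) := by
  have := Runs.loop_seq (P := .dec r) (r := r) (fun j => update s r (s r - j)) (s r) (by simp)
    (fun j hj => by
      convert Runs.dec' (r := r) (s := update s r (s r - j)) (by simp; omega) using 1
      simp [Nat.sub_sub])
  simpa [clear] using this

/-- Add the register `a` to the register `b`, clearing `a`. -/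
def move (a b : ℕ) : Prog := .loop a (.seq (.dec a) (.inc b))

theorem runs_move {a b : ℕ} (hab : a ≠ b) (s : ℕ → ℕ) :
    Runs (move a b) s (update (update s a 0) b (s b + s a)) := by
  have := Runs.loop_seq (P := .seq (.dec a) (.inc b)) (r := a)
    (fun j => update (update s a (s a - j)) b (s b + j)) (s a) (by simp [hab]) (fun j hj => by
      refine (Runs.dec' (by simp [hab]; omega)).seq ?_
      convert Runs.inc b _ using 1
      funext x
      simp only [update_apply]
      grind)
  simpa [move] using this

/-- Add the register `a` to the registers `b` and `c`, clearing `a`. -/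
def split (a b c : ℕ) : Prog := .loop a (.seq (.dec a) (.seq (.inc b) (.inc c)))

theorem runs_split {a b c : ℕ} (hab : a ≠ b) (hac : a ≠ c) (hbc : b ≠ c) (s : ℕ → ℕ) :
    Runs (split a b c) s (update (update (update s a 0) b (s b + s a)) c (s c + s a)) := by
  have := Runs.loop_seq (P := .seq (.dec a) (.seq (.inc b) (.inc c))) (r := a)
    (fun j => update (update (update s a (s a - j)) b (s b + j)) c (s c + j)) (s a)
    (by simp [hab, hac]) (fun j hj => by
      refine (Runs.dec' (by simp [hab, hac]; omega)).seq ((Runs.inc b _).seq ?_)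
      convert Runs.inc c _ using 1
      funext x
      simp only [update_apply]
      grind)
  simpa [split] using this

/-- Add the register `a` to the register `b`, using the empty register `c`. -/
def copy (a b c : ℕ) : Prog := .seq (split a b c) (move c a)

theorem runs_copy {a b c : ℕ} (hab : a ≠ b) (hac : a ≠ c) (hbc : b ≠ c) (s : ℕ → ℕ)
    (hc : s c = 0) : Runs (copy a b c) s (update s b (s b + s a)) := by
  refine ((runs_split hab hac hbc s).seq (runs_move hac.symm _)).of_eq ?_
  funext x
  simp only [update_apply]
  grind

/-- Do nothing. -/
def skip : Prog := .seq (.inc 0) (.dec 0)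

theorem runs_skip (s : ℕ → ℕ) : Runs skip s s := (Runs.inc 0 s).seq (Runs.dec 0 s)

/-- A function is computable by a register machine, with arbitrary disjoint input and output
registers, all registers from `base` on being available as work space. -/
def RegComputable {n : ℕ} (f : List.Vector ℕ n → ℕ) : Prop :=
  ∀ (ins : Fin n → ℕ) (out base : ℕ), (∀ i, ins i < base) → out < base → (∀ i, ins i ≠ out) →
    ∃ P, ∀ s : ℕ → ℕ, s out = 0 → (∀ r, base ≤ r → s r = 0) →
      Runs P s (update s out (f (List.Vector.ofFn fun i => s (ins i))))

theorem exists_clear (base j : ℕ) :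
    ∃ P, ∀ s : ℕ → ℕ, Runs P s (fun r => if base ≤ r ∧ r < base + j then 0 else s r) := by
  induction j with
  | zero => exact ⟨skip, fun s => (runs_skip s).of_eq (by funext x; grind)⟩
  | succ j ih =>
    obtain ⟨P, hP⟩ := ih
    refine ⟨.seq P (clear (base + j)), fun s => ?_⟩
    convert (hP s).seq (runs_clear _ _) using 1
    funext x
    simp only [update_apply]
    grind

theorem RegComputable.exists_parallel {n m : ℕ} (g : Fin m → List.Vector ℕ n → ℕ)
    (hg : ∀ i, RegComputable (g i)) (ins : Fin n → ℕ) (base : ℕ) (hins : ∀ i, ins i < base)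
    (j : ℕ) (hj : j ≤ m) : ∃ P, ∀ s : ℕ → ℕ, (∀ r, base ≤ r → s r = 0) → Runs P s
      (fun r => if h : base ≤ r ∧ r < base + j then
        g ⟨r - base, by omega⟩ (List.Vector.ofFn fun i => s (ins i)) else s r) := by
  induction j with
  | zero => exact ⟨skip, fun s _ => (runs_skip s).of_eq (by funext x; grind)⟩
  | succ j ih =>
    obtain ⟨P, hP⟩ := ih (by omega)
    obtain ⟨P', hP'⟩ := hg ⟨j, hj⟩ ins (base + j) (base + j + 1)
      (fun i => (hins i).trans_le (by omega)) (by omega) (fun i => by have := hins i; omega)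
    refine ⟨.seq P P', fun s hs => ?_⟩
    convert (hP s hs).seq (hP' _ ?_ ?_) using 1
    · funext x
      have : ∀ i, ¬ (base ≤ ins i) := fun i => by have := hins i; omega
      simp only [update_apply, this, false_and, dite_false]
      grind
    · simp [hs]
    · intro r hr
      rw [dif_neg (by omega)]
      exact hs _ (by omega)

theorem RegComputable.of_primrec' {n : ℕ} {f : List.Vector ℕ n → ℕ} (hf : Nat.Primrec' f) :
    RegComputable f := by
  induction hf with
  | zero =>
    intro ins out base _ _ _
    refine ⟨skip, fun s hs _ => ?_⟩
    convert runs_skip s using 1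
    rw [update_eq_self_iff]
    exact hs.symm
  | succ =>
    intro ins out base hi ho hio
    refine ⟨.seq (copy (ins 0) out base) (.inc out), fun s hs hb => ?_⟩
    convert (runs_copy (hio 0) (hi 0).ne ho.ne s (hb _ le_rfl)).seq (Runs.inc out _) using 1
    simp [hs]
  | get i =>
    intro ins out base hi ho hio
    refine ⟨copy (ins i) out base, fun s hs hb => ?_⟩
    convert runs_copy (hio i) (hi i).ne ho.ne s (hb _ le_rfl) using 1
    simp [hs]
  | @comp m n f g _ _ hf hg =>
    intro ins out base hi ho hio
    obtain ⟨P₁, h₁⟩ := RegComputable.exists_parallel g hg ins base hi n le_rfl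
    obtain ⟨P₂, h₂⟩ := hf (fun i => base + i) out (base + n) (by simp) (by omega)
      (fun i => by omega)
    obtain ⟨P₃, h₃⟩ := exists_clear base n
    refine ⟨.seq P₁ (.seq P₂ P₃), fun s hs hb => ?_⟩
    convert (h₁ s hb).seq ((h₂ _ ?_ ?_).seq (h₃ _)) using 1
    · funext x
      simp only [update_apply]
      simp
      grind
    · rw [dif_neg (by omega), hs]
    · intro r hr
      rw [dif_neg (by omega)]
      exact hb _ (by omega)
  | @prec n f g _ _ hf hg =>
    intro ins out base hi ho hio
    obtain ⟨P₁, h₁⟩ := hf (fun i => ins i.succ) out (base + 3) (fun i => (hi _).trans (by omega))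
      (by omega) (fun i => hio _)
    obtain ⟨P₂, h₂⟩ := hg (Fin.cons (base + 1) (Fin.cons out fun i => ins i.succ)) (base + 2)
      (base + 3) (by
        refine Fin.cases (by simp) (Fin.cases ?_ fun i => ?_)
        · simp; omega
        · simp only [Fin.cons_succ]; exact (hi _).trans (by omega)) (by omega) (by
        refine Fin.cases (by simp) (Fin.cases ?_ fun i => ?_)
        · simp; omega
        · simp only [Fin.cons_succ]; have := hi i.succ; omega)
    refine ⟨.seq (copy (ins 0) base (base + 1)) (.seq P₁ (.seq (.loop base (.seq (.dec base)
      (.seq P₂ (.seq (clear out) (.seq (move (base + 2) out) (.inc (base + 1)))))))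
      (clear (base + 1)))), fun s hs hb => ?_⟩
    let v : List.Vector ℕ n := List.Vector.ofFn fun i => s (ins i.succ)
    let val : ℕ → ℕ := fun j => j.rec (f v) fun y IH => g (y ::ᵥ IH ::ᵥ v)
    let st : ℕ → ℕ → ℕ := fun j =>
      update (update (update s base (s (ins 0) - j)) (base + 1) j) out (val j)
    have i0 : ∀ i, ins i ≠ base := fun i => (hi i).ne
    have i1 : ∀ i, ins i ≠ base + 1 := fun i => by have := hi i; omega
    have o1 : out ≠ base + 1 := by omega
    have o2 : base + 2 ≠ out := by omega
    have hloop := Runs.loop_seq (r := base) (P := .seq (.dec base)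
      (.seq P₂ (.seq (clear out) (.seq (move (base + 2) out) (.inc (base + 1)))))) st (s (ins 0))
      (fun j => by simp [st, ho.ne']) (fun j hj => by
        have hgv : List.Vector.ofFn (fun i => (update (st j) base (st j base - 1))
            ((Fin.cons (base + 1) (Fin.cons out fun i => ins i.succ) : Fin (n + 2) → ℕ) i)) =
            j ::ᵥ val j ::ᵥ v := by
          simp [List.Vector.ofFn, st, v, ho.ne, hio, i0, i1, o1.symm]
        refine ((Runs.dec' ?_).seq ((h₂ _ ?_ ?_).seq ((runs_clear _ _).seq
          ((runs_move o2 _).seq (Runs.inc _ _))))).of_eq ?_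
        · simp [st, ho.ne']; omega
        · simp [st, o2, hb]
        · intro r hr
          have := hb r (by omega)
          simp only [update_apply, st]
          grind
        · rw [hgv]
          funext x
          have e : val (j + 1) = g (j ::ᵥ val j ::ᵥ v) := rfl
          have := hb (base + 2) (by omega)
          simp only [update_apply, st, e]
          grind)
    have hstart := (runs_copy (i0 0) (i1 0) (by omega : base ≠ base + 1) s (hb _ (by omega))).seq
      (h₁ _ ?_ ?_)
    · refine Runs.of_eq (t := update (st (s (ins 0))) (base + 1) 0) ?_ ?_
      · intro X
        refine Iff.trans (hstart _) ?_
        have e : update (update s base (s base + s (ins 0))) out (f (List.Vector.ofFn fun i =>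
            update s base (s base + s (ins 0)) (ins i.succ))) = st 0 := by
          funext x
          have h0 := hb base (by omega)
          have h1 := hb (base + 1) (by omega)
          have ev : (List.Vector.ofFn fun i =>
              update s base (s base + s (ins 0)) (ins i.succ)) = v := by simp [v, i0]
          have e0 : f v = val 0 := rfl
          rw [ev, e0]
          simp only [update_apply, st, h0]
          grind
        rw [e]
        exact (hloop.seq (runs_clear _ _)) X
      · have e : val (s (ins 0)) = (List.Vector.ofFn fun i => s (ins i)).head.rec
            (f (List.Vector.ofFn fun i => s (ins i)).tail)
            (fun y IH => g (y ::ᵥ IH ::ᵥ (List.Vector.ofFn fun i => s (ins i)).tail)) := by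
          simp [val, v]
        beta_reduce
        rw [← e]
        funext x
        have h0 := hb base (by omega)
        have h1 := hb (base + 1) (by omega)
        simp only [update_apply, st]
        grind
    · simp [ho.ne, hs]
    · intro r hr
      rw [update_of_ne (by omega)]
      exact hb _ (by omega)

theorem exists_search {F : ℕ → ℕ → ℕ}
    (hF : Nat.Primrec' fun v : List.Vector ℕ 2 => F v.head v.tail.head) :
    ∃ P, ∀ X : Set (ℕ → ℕ), (0 : ℕ → ℕ) ∈ X → ∀ n,
      update (0 : ℕ → ℕ) 0 n ∈ regs.wp P X ↔ ∃ k, F n k = 0 := by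
  obtain ⟨P, hP⟩ := RegComputable.of_primrec' hF (fun i => i) 2 3 (fun i => by omega) (by omega)
    (fun i => by omega)
  let st : ℕ → ℕ → ℕ → ℕ := fun n k => update (update (update 0 0 n) 1 k) 2 (F n k)
  have hrun : ∀ n k, Runs P (update (update 0 0 n) 1 k) (st n k) := fun n k => by
    refine (hP _ (by simp) (fun r hr => ?_)).of_eq ?_
    · rw [update_of_ne (by omega), update_of_ne (by omega)]
      rfl
    · simp [st, List.Vector.ofFn]
  let body : Prog := .seq (clear 2) (.seq (.inc 1) P)
  have hbody : ∀ n k, Runs body (st n k) (st n (k + 1)) := fun n k => by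
    refine (runs_clear 2 _).seq (((Runs.inc 1 _).of_eq ?_).seq (hrun n (k + 1)))
    funext x
    simp only [st, update_apply, Pi.zero_apply]
    grind
  have hend : ∀ n k, F n k = 0 → Runs (.seq (clear 0) (clear 1)) (st n k) 0 := fun n k h => by
    refine ((runs_clear 0 _).seq (runs_clear 1 _)).of_eq ?_
    funext x
    simp only [st, update_apply, Pi.zero_apply]
    grind
  refine ⟨.seq P (.seq (.loop 2 body) (.seq (clear 0) (clear 1))), fun X hX n => ?_⟩
  have hstart : Runs P (update 0 0 n) (st n 0) := by
    convert hrun n 0 using 1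
    simp
  refine (hstart _).trans ⟨fun h => ?_, fun h => ?_⟩
  · by_contra! hne
    refine h {s | ∀ k, s ≠ st n k} ?_ 0 rfl
    rintro s hs k rfl
    rcases hs with ⟨hz, -⟩ | ⟨-, hs⟩
    · exact hne k (by simpa [regs, st] using hz)
    · exact (hbody n k _).1 hs (k + 1) rfl
  · classical
    have hk := Nat.find_spec h
    have hlt := fun j (hj : j < Nat.find h) => Nat.find_min h hj
    set K := Nat.find h
    suffices ∀ i ≤ K, Runs (.loop 2 body) (st n (K - i)) (st n K) by
      have h1 := this K le_rfl
      rw [Nat.sub_self] at h1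
      exact (h1 _).2 ((hend n K hk _).2 hX)
    intro i hi
    induction i with
    | zero => exact Runs.loop_zero _ (by simp [st, hk])
    | succ i ih =>
      refine Runs.loop_step (by simpa [st] using hlt _ (by omega)) (hbody n _) ?_
      rw [show K - (i + 1) + 1 = K - i by omega]
      exact ih (by omega)

end Registers

theorem exists_prog {F : ℕ → ℕ → ℕ} (hF : Primrec₂ F) :
    ∃ P : Prog, ∀ n, ((2 ^ n : ℕ) : ℤ) ∈ accepted [P] ↔ ∃ k, F n k = 0 := by
  obtain ⟨P, hP⟩ := exists_search (F := F) (Nat.Primrec'.of_prim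
    (hF.comp Primrec.vector_head (Primrec.vector_head.comp Primrec.vector_tail)))
  let d := P.bound + 1
  have h := goedel_mem_wp d P (Nat.le_succ _) {1}
  refine ⟨P, fun n => ?_⟩
  have : goedel d (Function.update 0 0 n) = 2 ^ n := by
    unfold goedel
    rw [Finset.prod_eq_single 0]
    · simp [Nat.nth_prime_zero_eq_two]
    · intro r _ hr
      simp [Function.update_of_ne hr]
    · simp [d]
  rw [← hP {t | (goedel d t : ℤ) ∈ ({1} : Set ℤ)} (by simp [goedel]), ← h, this]
  simp [accepted]

open Nat.Partrec (Code)

theorem exists_prog_diagonal (v : ℕ) :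
    ∃ P : Prog, ∀ e, ((2 ^ e : ℕ) : ℤ) ∈ accepted [P] ↔
      v ∈ (Denumerable.ofNat Code e).eval e := by
  have hF : Primrec₂ fun e k => if (Denumerable.ofNat Code e).evaln k e = some v then 0 else 1 := by
    refine Primrec.ite (PrimrecRel.comp Primrec.eq (Code.primrec_evaln.comp ((Primrec.pair
      Primrec.snd ((Primrec.ofNat Code).comp Primrec.fst)).pair Primrec.fst))
      (Primrec.const (some v))) (Primrec.const 0) (Primrec.const 1)
  obtain ⟨P, hP⟩ := exists_prog hF
  refine ⟨P, fun e => (hP e).trans ?_⟩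
  rw [Code.evaln_complete]
  simp

section FreeProduct

variable {a b : ℕ}

/-- The presentation of the free product of two presented groups. -/
def freeProduct (R : List (Word a)) (S : List (Word b)) : FinPres :=
  ⟨a + b, R.map (List.map (Prod.map (Fin.castAdd b) id)) ++
    S.map (List.map (Prod.map (Fin.natAdd a) id))⟩

theorem lift_mk_map {α β G : Type} [Group G] (f : α → β) (g : β → G) (r : List (α × Bool)) :
    FreeGroup.lift g (FreeGroup.mk (r.map (Prod.map f id))) =
      FreeGroup.lift (g ∘ f) (FreeGroup.mk r) := by
  simp [FreeGroup.lift_mk, Function.comp_def]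

theorem kills_freeProduct {G : Type} [Group G] (R : List (Word a)) (S : List (Word b))
    (g : Fin (a + b) → G) :
    Kills g (freeProduct R S).2 ↔
      Kills (g ∘ Fin.castAdd b) R ∧ Kills (g ∘ Fin.natAdd a) S := by
  simp only [Kills, freeProduct, List.mem_append, or_imp, forall_and, List.forall_mem_map,
    lift_mk_map]

theorem kills_proj (P : FinPres) : Kills (fun i => P.proj (FreeGroup.of i)) P.2 := by
  intro r hr
  have : FreeGroup.lift (fun i => P.proj (FreeGroup.of i)) = P.proj := by
    ext
    simp
  rw [this]
  exact PresentedGroup.one_of_mem ⟨r, hr, rfl⟩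

theorem nontrivial_of_kills {P : FinPres} {G : Type} [Group G] {g : Fin P.1 → G}
    (hg : Kills g P.2) {i : Fin P.1} (hi : g i ≠ 1) : Nontrivial P.Grp := by
  have h : ∀ r ∈ P.rels, FreeGroup.lift g r = 1 := by
    rintro _ ⟨r, hr, rfl⟩
    exact hg r hr
  refine ⟨PresentedGroup.of i, 1, fun h1 => hi ?_⟩
  rw [← PresentedGroup.toGroup.of h, h1, map_one]

theorem kills_one {m : ℕ} {G : Type} [Group G] (R : List (Word m)) : Kills (1 : Fin m → G) R := by
  intro r _
  have : FreeGroup.lift (1 : Fin m → G) = 1 := by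
    ext
    simp
  rw [this, MonoidHom.one_apply]

theorem primrec_encode_freeProduct {R : ℕ → List (Word a)} {S : ℕ → List (Word b)}
    (hR : Primrec R) (hS : Primrec S) :
    Primrec fun n => Encodable.encode (freeProduct (R n) (S n)) := by
  have key : ∀ {c : ℕ} {T : ℕ → List (Word c)} (_ : Primrec T) (f : Fin c → Fin (a + b)),
      Primrec fun n => (T n).map (List.map (Prod.map f id)) := fun hT f =>
    Primrec.list_map hT (Primrec.list_map Primrec.snd
      ((Primrec.pair ((Primrec.dom_finite f).comp (Primrec.fst.comp Primrec.snd))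
        (Primrec.snd.comp Primrec.snd)).to₂)).to₂
  exact Primrec₂.natPair.comp (Primrec.const (a + b))
    (Primrec.encode.comp (Primrec.list_append.comp (key hR _) (key hS _)))

end FreeProduct

end NontrivialGenerator

open NontrivialGenerator Nat.Partrec

/-- Corollary 4.3 (Chiodo): there is no algorithm that, on input of a finite
presentation of a nontrivial group, halts and outputs a generator which is
nontrivial in the presented group. -/
theorem no_algorithm_nontrivial_generator :
    ¬ ∃ g : ℕ →. ℕ, Nat.Partrec g ∧
      ∀ P : FinPres, Nontrivial P.Grp →
        ∃ i : Fin P.1,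
          (i : ℕ) ∈ g (Encodable.encode P) ∧ P.proj (FreeGroup.of i) ≠ 1 := by
  rintro ⟨g, hg, hspec⟩
  obtain ⟨PA, hPA⟩ := exists_prog_diagonal 0
  obtain ⟨PB, hPB⟩ := exists_prog_diagonal 1
  obtain ⟨a, R, hR, hA⟩ := PA.exists_presentation
  obtain ⟨b, S, hS, hB⟩ := PB.exists_presentation
  simp only [hPA] at hA
  simp only [hPB] at hB
  have hnontriv : ∀ e, Nontrivial (freeProduct (R e) (S e)).Grp := fun e => by
    by_cases h0 : 0 ∈ (Denumerable.ofNat Code e).eval e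
    · obtain ⟨G, _, k, hk, i, hi⟩ := (hB e).2 fun h1 => zero_ne_one (Part.mem_unique h0 h1)
      refine nontrivial_of_kills (g := Fin.addCases 1 k) (i := Fin.natAdd a i)
        ((kills_freeProduct _ _ _).2 ⟨?_, ?_⟩) (by simpa using hi)
      · convert kills_one (R e) (G := G)
        ext
        simp
      · convert hk
        ext
        simp
    · obtain ⟨G, _, k, hk, i, hi⟩ := (hA e).2 h0
      refine nontrivial_of_kills (g := Fin.addCases k 1) (i := Fin.castAdd b i)
        ((kills_freeProduct _ _ _).2 ⟨?_, ?_⟩) (by simpa using hi)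
      · convert hk
        ext
        simp
      · convert kills_one (S e) (G := G)
        ext
        simp
  let side : ℕ → ℕ := fun i => if i < a then 0 else 1
  have hside : Computable side := (Primrec.ite (Primrec.nat_lt.comp Primrec.id (Primrec.const a))
    (Primrec.const 0) (Primrec.const 1)).to_comp
  have hf : Partrec fun e : ℕ =>
      (g (Encodable.encode (freeProduct (R e) (S e)))).map side :=
    ((Partrec.nat_iff.2 hg).comp (primrec_encode_freeProduct hR hS).to_comp).map
      (hside.comp Computable.snd).to₂
  obtain ⟨c, hc⟩ := Code.exists_code.1 (Partrec.nat_iff.1 hf)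
  set e := Encodable.encode c with he
  obtain ⟨i, hi, hne⟩ := hspec _ (hnontriv e)
  have hmem : side i ∈ (Denumerable.ofNat Code e).eval e := by
    rw [he, Denumerable.ofNat_encode, hc]
    exact Part.mem_map side hi
  obtain ⟨hkA, hkB⟩ := (kills_freeProduct _ _ _).1 (kills_proj (freeProduct (R e) (S e)))
  refine hne ?_
  change Fin (a + b) at i
  induction i using Fin.addCases with
  | left i => exact (hA e).1 (by simpa [side] using hmem) _ _ hkA i
  | right i => exact (hB e).1 (by simpa [side] using hmem) _ _ hkB i
end

section
/- Fix any k > 0. There is no algorithm (partial recursive function on codes) that, on input of a code of a finite presentation P = (m, R) whose presented group is non-abelian, halts and outputs codes of two words w, w' : List (Fin m × Bool), each of length at most k, such that the commutator [w̄, w̄'] of their images in the presented group of P is nontrivial (i.e. the images of w and w' do not commute). -/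
theorem partrec_comp_log_two {f : ℕ →. ℕ} (hf : Nat.Partrec f) :
    ∃ f' : ℕ →. ℕ, Partrec f' ∧ ∀ n, (f' (2 ^ n)).Dom ↔ (f n).Dom := by
  refine ⟨fun N => (Nat.rfind fun k => Part.some (decide (2 ^ k = N))).bind f, ?_, fun n => ?_⟩
  · have hpow : Primrec₂ ((· ^ ·) : ℕ → ℕ → ℕ) := Primrec₂.unpaired'.1 Nat.Primrec.pow
    have h : Partrec₂ fun (N k : ℕ) => (Part.some (decide (2 ^ k = N)) : Part Bool) := by
      refine Computable.partrec (f := fun p : ℕ × ℕ => decide (2 ^ p.2 = p.1)) ?_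
      exact (Primrec.beq.comp (hpow.comp (Primrec.const 2) Primrec.snd) Primrec.fst).to_comp
    exact (Partrec.rfind h).bind ((Partrec.nat_iff.2 hf).comp Computable.snd)
  · have : (Nat.rfind fun k => Part.some (decide (2 ^ k = 2 ^ n))) = Part.some n := by
      refine Part.eq_some_iff.2 (Nat.mem_rfind.2 ⟨by simp, fun {m} hm => ?_⟩)
      have : 2 ^ m ≠ 2 ^ n := (Nat.pow_lt_pow_right (by norm_num) hm).ne
      simp [this]
    simp only [this]
    exact Iff.of_eq (congrArg Part.Dom (Part.bind_some n f))

open Turing in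
theorem trNat_two_pow (n : ℕ) :
    PartrecToTM2.trNat (2 ^ n) =
      List.replicate n PartrecToTM2.Γ'.bit0 ++ [PartrecToTM2.Γ'.bit1] := by
  suffices h : ∃ p : PosNum, ((2 ^ n : ℕ) : Num) = Num.pos p ∧ PartrecToTM2.trPosNum p =
      List.replicate n PartrecToTM2.Γ'.bit0 ++ [PartrecToTM2.Γ'.bit1] by
    obtain ⟨p, hp, h⟩ := h
    rw [PartrecToTM2.trNat, hp, ← h]; rfl
  induction n with
  | zero => exact ⟨1, rfl, rfl⟩
  | succ n ih =>
    obtain ⟨p, hp, h⟩ := ih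
    refine ⟨PosNum.bit0 p, ?_, ?_⟩
    · rw [pow_succ, mul_two, Nat.cast_add, hp]
      exact Num.bit0_of_bit0 (Num.pos p)
    · rw [PartrecToTM2.trPosNum, h]; rfl

open Turing in
theorem exists_turingMachine {f : ℕ →. ℕ} (hf : Nat.Partrec f) :
    ∃ (Γ Λ : Type) (_ : Inhabited Γ) (_ : Finite Γ) (_ : Inhabited Λ) (M : TM0.Machine Γ Λ)
      (S : Finset Λ) (a b c : Γ), TM0.Supports M (S : Set Λ) ∧ ∀ n,
        (StateTransition.eval (TM0.step M) (TM0.init (a :: b :: List.replicate n c))).Dom ↔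
          (f n).Dom := by
  obtain ⟨f', hf', hdom⟩ := partrec_comp_log_two hf
  obtain ⟨c, hc⟩ := ToPartrec.Code.exists_code (Nat.Partrec'.part_iff₁.2 hf')
  let _ : Inhabited PartrecToTM2.Λ' := ⟨PartrecToTM2.trNormal c PartrecToTM2.Cont'.halt⟩
  let M₁ := TM2to1.tr PartrecToTM2.tr
  let e (x : PartrecToTM2.Γ') : TM2to1.Γ' PartrecToTM2.K' (fun _ => PartrecToTM2.Γ') :=
    (false, Function.update (fun _ => none) PartrecToTM2.K'.main (some x))
  let e' : TM2to1.Γ' PartrecToTM2.K' (fun _ => PartrecToTM2.Γ') :=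
    (true, Function.update (fun _ => none) PartrecToTM2.K'.main (some PartrecToTM2.Γ'.cons))
  have hfin : Finite (TM2to1.Γ' PartrecToTM2.K' (fun _ => PartrecToTM2.Γ')) := by
    have : Finite PartrecToTM2.K' :=
      Finite.of_injective (fun k => match k with
        | .main => (0 : Fin 4) | .rev => 1 | .aux => 2 | .stack => 3)
        (by rintro (_ | _ | _ | _) (_ | _ | _ | _) h <;> first | rfl | simp at h)
    have := Fintype.ofFinite PartrecToTM2.K'
    exact @Finite.of_fintype _ (TM2to1.Γ'.fintype (Γ := fun _ : PartrecToTM2.K' => PartrecToTM2.Γ'))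
  refine ⟨TM2to1.Γ' PartrecToTM2.K' (fun _ => PartrecToTM2.Γ'), TM1to0.Λ' M₁, inferInstance,
    hfin, inferInstance, TM1to0.tr M₁, _, e', e PartrecToTM2.Γ'.bit1, e PartrecToTM2.Γ'.bit0,
    TM1to0.tr_supports M₁ (TM2to1.tr_supports _ (PartrecToTM2.tr_supports c _)), fun n => ?_⟩
  have htape : TM2to1.trInit PartrecToTM2.K'.main (PartrecToTM2.trList [2 ^ n]) =
      e' :: e PartrecToTM2.Γ'.bit1 :: List.replicate n (e PartrecToTM2.Γ'.bit0) := by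
    have h : (PartrecToTM2.trList [2 ^ n]).reverse = PartrecToTM2.Γ'.cons ::
        PartrecToTM2.Γ'.bit1 :: List.replicate n PartrecToTM2.Γ'.bit0 := by
      simp [PartrecToTM2.trList, trNat_two_pow]
    rw [TM2to1.trInit, h]
    exact congrArg (fun l => e' :: e PartrecToTM2.Γ'.bit1 :: l) List.map_replicate
  have hinit : PartrecToTM2.init c [2 ^ n] =
      TM2.init PartrecToTM2.K'.main (PartrecToTM2.trList [2 ^ n]) := by
    refine congrArg (TM2.Cfg.mk _ _) (funext fun k => ?_)
    cases k <;> rfl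
  have h0 := congrArg Part.Dom (TM1to0.tr_eval M₁
    (TM2to1.trInit PartrecToTM2.K'.main (PartrecToTM2.trList [2 ^ n])))
  have h1 := TM2to1.tr_eval_dom PartrecToTM2.tr PartrecToTM2.K'.main
    (PartrecToTM2.trList [2 ^ n])
  have h2 := congrArg Part.Dom (PartrecToTM2.tr_eval c [2 ^ n])
  have h3 := congrArg Part.Dom (hc ⟨[2 ^ n], rfl⟩)
  rw [← htape, ← hdom]
  change (TM0.eval _ _).Dom ↔ _
  rw [h0, h1]
  change (StateTransition.eval _ _).Dom ↔ _
  rw [← hinit, h2]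
  exact Iff.of_eq h3

/-- An affine map `u ↦ scale * u + shift` of the plane `ℤ × ℤ`, tagged with a state. -/
structure Branch (σ : Type) where
  state : σ
  scale : ℤ × ℤ
  shift : ℤ × ℤ
  scale_fst_ne : scale.1 ≠ 0
  scale_snd_ne : scale.2 ≠ 0

/-- The configuration reached from `u` through a branch. -/
def Branch.eval {σ : Type} (b : Branch σ) (u : ℤ × ℤ) : σ × (ℤ × ℤ) :=
  (b.state, b.scale * u + b.shift)

/-- One application of one of the affine rules `rule i`. -/
def AffineStep {σ ι : Type} (rule : ι → Branch σ × Branch σ) (p q : σ × (ℤ × ℤ)) : Prop :=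
  ∃ i u, p = (rule i).1.eval u ∧ q = (rule i).2.eval u

/-- The digits of `N` in base `B` are the symbols of `l`, encoded by `e`. -/
def IsTapeCode {Γ : Type} [Inhabited Γ] (B : ℤ) (e : Γ → ℤ) (l : Turing.ListBlank Γ)
    (N : ℤ) : Prop :=
  ∀ i, N / B ^ i % B = e (l.nth i)

section IsTapeCode

variable {Γ : Type} [Inhabited Γ] {B : ℤ} {e : Γ → ℤ}

theorem isTapeCode_default (he : e default = 0) :
    IsTapeCode B e (Turing.ListBlank.mk ([] : List Γ)) 0 := fun i => by
  simp [Turing.ListBlank.nth_mk, List.getI, he]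

theorem IsTapeCode.eq_mul_add {l : Turing.ListBlank Γ} {N : ℤ} (h : IsTapeCode B e l N) :
    N = B * (N / B) + e l.head := by
  have := h 0
  rw [pow_zero, Int.ediv_one, Turing.ListBlank.nth_zero] at this
  rw [← this, Int.mul_ediv_add_emod]

theorem IsTapeCode.tail (hB : 0 < B) {l : Turing.ListBlank Γ} {N : ℤ} (h : IsTapeCode B e l N) :
    IsTapeCode B e l.tail (N / B) := fun i => by
  rw [Int.ediv_ediv_of_nonneg hB.le, ← pow_succ', ← Turing.ListBlank.nth_succ]
  exact h (i + 1)

theorem IsTapeCode.cons (hB : 0 < B) (he : ∀ a, 0 ≤ e a ∧ e a < B) {l : Turing.ListBlank Γ}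
    {N : ℤ} (h : IsTapeCode B e l N) (a : Γ) : IsTapeCode B e (l.cons a) (B * N + e a) := by
  rintro (_ | i)
  · simp [Turing.ListBlank.nth_zero, Int.emod_eq_of_lt (he a).1 (he a).2]
  · rw [pow_succ', ← Int.ediv_ediv_of_nonneg hB.le, Turing.ListBlank.nth_succ,
      Turing.ListBlank.tail_cons, Int.add_comm, Int.add_mul_ediv_left _ _ hB.ne',
      Int.ediv_eq_zero_of_lt (he a).1 (he a).2, zero_add]
    exact h i

theorem IsTapeCode.of_mul_add (hB : 0 < B) (he : ∀ a, 0 ≤ e a ∧ e a < B)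
    (hinj : Function.Injective e) {l : Turing.ListBlank Γ} {N : ℤ} {a : Γ}
    (h : IsTapeCode B e l (B * N + e a)) : IsTapeCode B e l.tail N ∧ l.head = a := by
  have hN : (B * N + e a) / B = N := by
    rw [Int.add_comm, Int.add_mul_ediv_left _ _ hB.ne',
      Int.ediv_eq_zero_of_lt (he a).1 (he a).2, zero_add]
  have h' := h.tail hB
  have h0 := h.eq_mul_add
  rw [hN] at h' h0
  exact ⟨h', hinj (by omega)⟩

end IsTapeCode

section MachineRule

open Turing

variable {Γ Λ : Type} (S : Finset Λ)

open Classical in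
/-- The state of the affine system for machine state `q` and scanned symbol `a`. -/
noncomputable def machineState (q : Λ) (a : Γ) : Option (S × Γ) :=
  if h : q ∈ S then some (⟨q, h⟩, a) else none

theorem machineState_eq {S : Finset Λ} {q : Λ} (h : q ∈ S) (a : Γ) :
    machineState S q a = some (⟨q, h⟩, a) := dif_pos h

variable [Inhabited Λ] (M : TM0.Machine Γ Λ)

/-- The affine rules simulating a Turing machine on pairs of tape codes. -/
noncomputable def machineRule (B : ℤ) (hB : B ≠ 0) (e : Γ → ℤ) : (S × Γ × Γ) ⊕ Bool →
    Branch (Option (S × Γ)) × Branch (Option (S × Γ))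
  | .inl (q, a, b) => match M q a with
    | none => (⟨some (q, a), 1, 0, one_ne_zero, one_ne_zero⟩,
        ⟨none, 1, 0, one_ne_zero, one_ne_zero⟩)
    | some (q', .write c) => (⟨some (q, a), 1, 0, one_ne_zero, one_ne_zero⟩,
        ⟨machineState S q' c, 1, 0, one_ne_zero, one_ne_zero⟩)
    | some (q', .move .right) => (⟨some (q, a), (1, B), (0, e b), one_ne_zero, hB⟩,
        ⟨machineState S q' b, (B, 1), (e a, 0), hB, one_ne_zero⟩)
    | some (q', .move .left) => (⟨some (q, a), (B, 1), (e b, 0), hB, one_ne_zero⟩,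
        ⟨machineState S q' b, (1, B), (0, e a), one_ne_zero, hB⟩)
  | .inr true => (⟨none, 1, (1, 0), one_ne_zero, one_ne_zero⟩,
      ⟨none, 1, 0, one_ne_zero, one_ne_zero⟩)
  | .inr false => (⟨none, 1, (0, 1), one_ne_zero, one_ne_zero⟩,
      ⟨none, 1, 0, one_ne_zero, one_ne_zero⟩)

theorem eqvGen_machineRule_none {S : Finset Λ} {M : TM0.Machine Γ Λ} {B : ℤ} {e : Γ → ℤ}
    (hB : B ≠ 0) (u : ℤ × ℤ) :
    Relation.EqvGen (AffineStep (machineRule S M B hB e)) (none, u) (none, 0) := by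
  have h₁ (x y : ℤ) : Relation.EqvGen (AffineStep (machineRule S M B hB e))
      (none, (x + 1, y)) (none, (x, y)) :=
    .rel _ _ ⟨.inr true, (x, y), by simp [machineRule, Branch.eval]⟩
  have h₂ (x y : ℤ) : Relation.EqvGen (AffineStep (machineRule S M B hB e))
      (none, (x, y + 1)) (none, (x, y)) :=
    .rel _ _ ⟨.inr false, (x, y), by simp [machineRule, Branch.eval]⟩
  have h₃ (y : ℤ) : Relation.EqvGen (AffineStep (machineRule S M B hB e))
      (none, (0, y)) (none, 0) := by
    induction y with
    | zero => exact .refl _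
    | succ y ih => exact .trans _ _ _ (h₂ _ _) ih
    | pred y ih => exact .trans _ _ _ (.symm _ _ (by simpa using h₂ 0 (-y - 1))) ih
  obtain ⟨x, y⟩ := u
  induction x with
  | zero => exact h₃ y
  | succ x ih => exact .trans _ _ _ (h₁ _ _) ih
  | pred x ih => exact .trans _ _ _ (.symm _ _ (by simpa using h₁ (-x - 1) y)) ih

variable [Inhabited Γ] {S} {M} {B : ℤ} {e : Γ → ℤ}

/-- A plane configuration whose decoded Turing machine configurations all halt. -/
def DecodesToHalting (M : TM0.Machine Γ Λ) (S : Finset Λ) (B : ℤ) (e : Γ → ℤ) :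
    Option (S × Γ) × (ℤ × ℤ) → Prop
  | (none, _) => True
  | (some (q, a), u) => ∀ l r, IsTapeCode B e l u.1 → IsTapeCode B e r u.2 →
      (StateTransition.eval (TM0.step M) ⟨q, ⟨a, l, r⟩⟩).Dom

theorem eval_dom_iff_of_step {c c' : TM0.Cfg Γ Λ} (h : TM0.step M c = some c') :
    (StateTransition.eval (TM0.step M) c).Dom ↔ (StateTransition.eval (TM0.step M) c').Dom := by
  rw [StateTransition.reaches_eval (Relation.ReflTransGen.single h)]

theorem decodesToHalting_machineRule (hS : TM0.Supports M (S : Set Λ)) (hB : 0 < B)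
    (he : ∀ a, 0 ≤ e a ∧ e a < B) (hinj : Function.Injective e) (i : (S × Γ × Γ) ⊕ Bool)
    (u : ℤ × ℤ) :
    DecodesToHalting M S B e ((machineRule S M B hB.ne' e i).1.eval u) ↔
      DecodesToHalting M S B e ((machineRule S M B hB.ne' e i).2.eval u) := by
  rcases i with ⟨q, a, b⟩ | (_ | _)
  · simp only [machineRule]
    split
    · next h =>
      simp only [Branch.eval, DecodesToHalting, iff_true]
      intro l r _ _
      refine Part.dom_iff_mem.2 ⟨_, StateTransition.mem_eval.2 ⟨Relation.ReflTransGen.refl, ?_⟩⟩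
      simp [TM0.step, h]
    · next q' c h =>
      have hq' : q' ∈ S := hS.2 h q.2
      simp only [Branch.eval, DecodesToHalting, machineState_eq hq']
      refine forall₄_congr fun l r _ _ => eval_dom_iff_of_step ?_
      simp [TM0.step, h, Tape.write]
    · next q' h =>
      have hq' : q' ∈ S := hS.2 h q.2
      simp only [Branch.eval, DecodesToHalting, machineState_eq hq', Prod.fst_add, Prod.fst_mul,
        Prod.snd_add, Prod.snd_mul, one_mul, add_zero]
      have key (l r : ListBlank Γ) : TM0.step M ⟨q, ⟨a, l, r.cons b⟩⟩ =
          some ⟨q', ⟨b, l.cons a, r⟩⟩ := by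
        simp [TM0.step, h, Tape.move]
      constructor
      · intro H l r hl hr
        obtain ⟨hl', rfl⟩ := hl.of_mul_add hB he hinj
        have := H l.tail (r.cons b) hl' (hr.cons hB he b)
        rwa [eval_dom_iff_of_step (key _ _), ListBlank.cons_head_tail] at this
      · intro H l r hl hr
        obtain ⟨hr', rfl⟩ := hr.of_mul_add hB he hinj
        have := H (l.cons a) r.tail (hl.cons hB he a) hr'
        rwa [← eval_dom_iff_of_step (key _ _), ListBlank.cons_head_tail] at this
    · next q' h =>
      have hq' : q' ∈ S := hS.2 h q.2
      simp only [Branch.eval, DecodesToHalting, machineState_eq hq', Prod.fst_add, Prod.fst_mul,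
        Prod.snd_add, Prod.snd_mul, one_mul, add_zero]
      have key (l r : ListBlank Γ) : TM0.step M ⟨q, ⟨a, l.cons b, r⟩⟩ =
          some ⟨q', ⟨b, l, r.cons a⟩⟩ := by
        simp [TM0.step, h, Tape.move]
      constructor
      · intro H l r hl hr
        obtain ⟨hr', rfl⟩ := hr.of_mul_add hB he hinj
        have := H (l.cons b) r.tail (hl.cons hB he b) hr'
        rwa [eval_dom_iff_of_step (key _ _), ListBlank.cons_head_tail] at this
      · intro H l r hl hr
        obtain ⟨hl', rfl⟩ := hl.of_mul_add hB he hinj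
        have := H l.tail (r.cons a) hl' (hr.cons hB he a)
        rwa [← eval_dom_iff_of_step (key _ _), ListBlank.cons_head_tail] at this
  · simp [machineRule, Branch.eval, DecodesToHalting]
  · simp [machineRule, Branch.eval, DecodesToHalting]

theorem eqvGen_machineRule_of_halts (hS : TM0.Supports M (S : Set Λ)) (hB : 0 < B)
    (he : ∀ a, 0 ≤ e a ∧ e a < B) {c d : TM0.Cfg Γ Λ} (hcd : StateTransition.Reaches (TM0.step M) c d)
    (hd : TM0.step M d = none) (hc : c.q ∈ S) {u : ℤ × ℤ} (hl : IsTapeCode B e c.Tape.left u.1)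
    (hr : IsTapeCode B e c.Tape.right u.2) :
    Relation.EqvGen (AffineStep (machineRule S M B hB.ne' e))
      (machineState S c.q c.Tape.head, u) (none, 0) := by
  induction hcd using Relation.ReflTransGen.head_induction_on generalizing u with
  | refl =>
    obtain ⟨q, ⟨a, l, r⟩⟩ := d
    have h : M q a = none := by simpa [TM0.step] using hd
    refine .trans _ (none, u) _ (.rel _ _ ⟨.inl (⟨q, hc⟩, a, a), u, ?_⟩)
      (eqvGen_machineRule_none hB.ne' u)
    simp [machineRule, h, Branch.eval, machineState_eq hc]
  | @head c c' hstep _ ih =>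
    have hc' := TM0.step_supports M hS hstep hc
    obtain ⟨q, ⟨a, l, r⟩⟩ := c
    obtain ⟨⟨q', s⟩, h, rfl⟩ := Option.map_eq_some_iff.1 hstep
    simp only at h hl hr hc hc' ih
    obtain ⟨x, y⟩ := u
    rcases s with (_ | _) | s
    · refine .trans _ _ _ (.rel _ _ ⟨.inl (⟨q, hc⟩, a, l.head), (x / B, y), ?_, rfl⟩)
        (cast ?_ (ih (u := (x / B, B * y + e a)) hc' (hl.tail hB) (hr.cons hB he a)))
      · simp [machineRule, h, Branch.eval, machineState_eq hc, ← hl.eq_mul_add]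
      · simp [machineRule, h, Branch.eval, Tape.move]
    · refine .trans _ _ _ (.rel _ _ ⟨.inl (⟨q, hc⟩, a, r.head), (x, y / B), ?_, rfl⟩)
        (cast ?_ (ih (u := (B * x + e a, y / B)) hc' (hl.cons hB he a) (hr.tail hB)))
      · simp [machineRule, h, Branch.eval, machineState_eq hc, ← hr.eq_mul_add]
      · simp [machineRule, h, Branch.eval, Tape.move]
    · refine .trans _ _ _ (.rel _ _ ⟨.inl (⟨q, hc⟩, a, a), (x, y), ?_, rfl⟩)
        (cast ?_ (ih (u := (x, y)) hc' hl hr))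
      · simp [machineRule, h, Branch.eval, machineState_eq hc]
      · simp [machineRule, h, Branch.eval, Tape.write]

end MachineRule

theorem exists_affine_system {f : ℕ →. ℕ} (hf : Nat.Partrec f) :
    ∃ (σ ι : Type) (_ : Finite σ) (_ : Finite ι) (rule : ι → Branch σ × Branch σ) (s h : σ)
      (R : ℕ → ℕ), Primrec R ∧
        ∀ n, (f n).Dom ↔ Relation.EqvGen (AffineStep rule) (s, (0, (R n : ℤ))) (h, 0) := by
  obtain ⟨Γ, Λ, _, _, _, M, S, a, b, c, hS, hM⟩ := exists_turingMachine hf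
  obtain ⟨m, ⟨eqv⟩⟩ := Finite.exists_equiv_fin Γ
  have : NeZero m := ⟨by rintro rfl; exact (eqv default).elim0⟩
  let d (x : Γ) : ℕ := (eqv x - eqv default : Fin m).val
  let e (x : Γ) : ℤ := d x
  have hB : (0 : ℤ) < m := by exact_mod_cast Nat.pos_of_neZero m
  have he (x : Γ) : 0 ≤ e x ∧ e x < m := ⟨by positivity, by
    exact Nat.cast_lt.2 (eqv x - eqv default : Fin m).isLt⟩
  have hinj : Function.Injective e := fun x y h => eqv.injective
    (sub_left_injective (Fin.ext (Nat.cast_injective h)))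
  have he0 : e default = 0 := by simp [e, d]
  let R (n : ℕ) : ℕ := m * n.rec 0 (fun _ x => m * x + d c) + d b
  have hR : Primrec R := by
    refine Primrec.nat_add.comp (Primrec.nat_mul.comp (Primrec.const m) ?_) (Primrec.const _)
    exact Primrec.nat_rec₁ 0 (Primrec.nat_add.comp (Primrec.nat_mul.comp (Primrec.const m)
      Primrec.snd) (Primrec.const _)).to₂
  have hcode (n : ℕ) : IsTapeCode (m : ℤ) e
      (Turing.ListBlank.mk (b :: List.replicate n c)) (R n) := by
    have h (n : ℕ) : IsTapeCode (m : ℤ) e (Turing.ListBlank.mk (List.replicate n c))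
        (n.rec 0 (fun _ x => m * x + d c) : ℕ) := by
      induction n with
      | zero => exact isTapeCode_default he0
      | succ n ih => simpa [List.replicate_succ, e] using ih.cons hB he c
    simpa [R, e] using (h n).cons hB he b
  refine ⟨Option (S × Γ), (S × Γ × Γ) ⊕ Bool, inferInstance, inferInstance,
    machineRule S M m hB.ne' e, machineState S default a, none, R, hR, fun n => ?_⟩
  rw [← hM n]
  constructor
  · intro h
    obtain ⟨d, hd⟩ := Part.dom_iff_mem.1 h
    obtain ⟨hreach, hd⟩ := StateTransition.mem_eval.1 hd
    exact eqvGen_machineRule_of_halts hS hB he hreach hd hS.1 (u := (0, (R n : ℤ)))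
      (isTapeCode_default he0) (hcode n)
  · intro h
    have key : DecodesToHalting M S m e (machineState S default a, (0, (R n : ℤ))) := by
      refine (Relation.EqvGen.rec (motive := fun p q _ => DecodesToHalting M S m e p ↔
        DecodesToHalting M S m e q) ?_ (fun _ => Iff.rfl) (fun _ _ _ => Iff.symm)
        (fun _ _ _ _ _ => Iff.trans) h).2 trivial
      rintro _ _ ⟨i, u, rfl, rfl⟩
      exact decodesToHalting_machineRule hS hB he hinj i u
    rw [machineState_eq hS.1] at key
    exact key _ _ (isTapeCode_default he0) (hcode n)

theorem Branch.eval_injective {σ : Type} (b : Branch σ) : Function.Injective b.eval := by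
  rintro ⟨x, y⟩ ⟨x', y'⟩ h
  simpa [Branch.eval, Prod.ext_iff, b.scale_fst_ne, b.scale_snd_ne] using h

/-- The unrestricted wreath product of `X → ℤ` by `ℤ²`: a lamp
configuration on `X` copies of the plane, together with a translation. -/
@[ext]
structure Lamp (X : Type) where
  lit : X × (ℤ × ℤ) → ℤ
  pos : ℤ × ℤ

namespace Lamp

variable {X : Type}

instance : Mul (Lamp X) where
  mul f g := ⟨fun p => f.lit p + g.lit (p.1, p.2 - f.pos), f.pos + g.pos⟩

instance : One (Lamp X) where
  one := ⟨0, 0⟩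

instance : Inv (Lamp X) where
  inv f := ⟨fun p => -f.lit (p.1, p.2 + f.pos), -f.pos⟩

@[simp] theorem mul_lit (f g : Lamp X) (p : X × (ℤ × ℤ)) :
    (f * g).lit p = f.lit p + g.lit (p.1, p.2 - f.pos) := rfl

@[simp] theorem mul_pos (f g : Lamp X) : (f * g).pos = f.pos + g.pos := rfl

@[simp] theorem one_lit : (1 : Lamp X).lit = 0 := rfl

@[simp] theorem one_pos : (1 : Lamp X).pos = 0 := rfl

@[simp] theorem inv_lit (f : Lamp X) (p : X × (ℤ × ℤ)) :
    f⁻¹.lit p = -f.lit (p.1, p.2 + f.pos) := rfl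

@[simp] theorem inv_pos (f : Lamp X) : f⁻¹.pos = -f.pos := rfl

instance : Group (Lamp X) := Group.ofLeftAxioms
  (fun f g h => by ext <;> simp [add_assoc, sub_sub])
  (fun f => by ext <;> simp)
  (fun f => by ext <;> simp)

/-- The translation by `u`. -/
def shift (u : ℤ × ℤ) : Lamp X := ⟨0, u⟩

open Classical in
/-- The configuration in which only the lamp at `p` is lit. -/
noncomputable def lamp (p : X × (ℤ × ℤ)) : Lamp X := ⟨Pi.single p 1, 0⟩

theorem shift_mul (u v : ℤ × ℤ) : (shift u * shift v : Lamp X) = shift (u + v) := by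
  ext <;> simp [shift]

theorem shift_zpow (u : ℤ × ℤ) (n : ℤ) : (shift u : Lamp X) ^ n = shift (n • u) := by
  have hinv : (shift u : Lamp X)⁻¹ = shift (-u) := by ext <;> simp [shift]
  induction n with
  | zero => rw [zpow_zero, zero_smul]; rfl
  | succ n ih => rw [zpow_add_one, ih, shift_mul, add_smul, one_smul]
  | pred n ih => rw [zpow_sub_one, ih, hinv, shift_mul, sub_smul, one_smul, sub_eq_add_neg]

theorem shift_conj_lamp (u : ℤ × ℤ) (s : X) (v : ℤ × ℤ) :
    shift u * lamp (s, v) * (shift u)⁻¹ = lamp (s, u + v) := by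
  classical
  ext p
  · simp [shift, lamp, Pi.single_apply, Prod.ext_iff, sub_eq_iff_eq_add, add_comm]
  · simp [shift, lamp]
  · simp [shift, lamp]

/-- The configurations without translation which are supported on `Z`. -/
def supported (Z : Set (X × (ℤ × ℤ))) : Subgroup (Lamp X) where
  carrier := {f | f.pos = 0 ∧ ∀ p ∉ Z, f.lit p = 0}
  mul_mem' := by
    rintro f g ⟨hf, hf'⟩ ⟨hg, hg'⟩
    exact ⟨by simp [hf, hg], fun p hp => by simp [hf, hf' p hp, hg' p hp]⟩
  one_mem' := ⟨rfl, fun _ _ => rfl⟩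
  inv_mem' := by
    rintro f ⟨hf, hf'⟩
    exact ⟨by simp [hf], fun p hp => by simp [hf, hf' p hp]⟩

theorem lamp_mem_supported {Z : Set (X × (ℤ × ℤ))} {p : X × (ℤ × ℤ)} :
    lamp p ∈ supported Z ↔ p ∈ Z := by
  classical
  constructor
  · rintro ⟨-, h⟩
    by_contra hp
    simpa [lamp] using h p hp
  · refine fun hp => ⟨rfl, fun q hq => ?_⟩
    have : q ≠ p := by rintro rfl; exact hq hp
    simp [lamp, this]

/-- The embedding of lamp groups induced by an affine map. -/
noncomputable def branchHom {σ : Type} (b : Branch σ) : Lamp Unit →* Lamp σ :=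
  MonoidHom.mk' (fun f => ⟨Function.extend b.eval (fun v => f.lit ((), v)) 0, b.scale * f.pos⟩) <| by
    intro f g
    ext p
    · simp only [mul_lit]
      by_cases hp : ∃ v, b.eval v = p
      · obtain ⟨v, rfl⟩ := hp
        have : ((b.eval v).1, (b.eval v).2 - b.scale * f.pos) = b.eval (v - f.pos) := by
          simp only [Branch.eval, mul_sub]; congr 1; abel
        simp only [this, b.eval_injective.extend_apply]
      · have hp' : ¬ ∃ v, b.eval v = (p.1, p.2 - b.scale * f.pos) := by
          rintro ⟨v, hv⟩
          refine hp ⟨v + f.pos, ?_⟩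
          have h₁ := congrArg Prod.fst hv
          have h₂ := congrArg Prod.snd hv
          simp only [Branch.eval] at h₁ h₂
          ext1
          · exact h₁
          · rw [Branch.eval, mul_add, add_right_comm, h₂, sub_add_cancel]
        simp [Function.extend_apply' _ _ _ hp, Function.extend_apply' _ _ _ hp']
    · simp [mul_add]
    · simp [mul_add]

variable {σ : Type} (b : Branch σ)

theorem branchHom_pos_eq_zero (f : Lamp Unit) : (branchHom b f).pos = 0 ↔ f.pos = 0 := by
  change b.scale * f.pos = 0 ↔ _
  simp [Prod.ext_iff, b.scale_fst_ne, b.scale_snd_ne]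

theorem branchHom_lit (f : Lamp Unit) :
    (branchHom b f).lit = Function.extend b.eval (fun v => f.lit ((), v)) 0 := rfl

theorem branchHom_lit_eval (f : Lamp Unit) (v : ℤ × ℤ) :
    (branchHom b f).lit (b.eval v) = f.lit ((), v) := by
  rw [branchHom_lit, b.eval_injective.extend_apply]

theorem branchHom_lit_of_not (f : Lamp Unit) {p : σ × (ℤ × ℤ)} (hp : ¬ ∃ v, b.eval v = p) :
    (branchHom b f).lit p = 0 := by
  rw [branchHom_lit, Function.extend_apply' _ _ _ hp]; rfl

theorem branchHom_injective : Function.Injective (branchHom b) := by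
  refine (injective_iff_map_eq_one _).2 fun f hf => ?_
  ext1
  · ext ⟨⟨⟩, v⟩
    rw [← branchHom_lit_eval b, hf]; rfl
  · rw [one_pos, ← branchHom_pos_eq_zero b, hf]; rfl

theorem branchHom_mem_supported (Z : Set (σ × (ℤ × ℤ))) (f : Lamp Unit) :
    branchHom b f ∈ supported Z ↔ f.pos = 0 ∧ ∀ v, b.eval v ∉ Z → f.lit ((), v) = 0 := by
  refine and_congr (branchHom_pos_eq_zero b f) ⟨fun h v hv => ?_, fun h p hp => ?_⟩
  · rw [← branchHom_lit_eval b, h _ hv]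
  · by_cases hp' : ∃ v, b.eval v = p
    · obtain ⟨v, rfl⟩ := hp'
      rw [branchHom_lit_eval, h v hp]
    · exact branchHom_lit_of_not b f hp'

theorem branchHom_shift (u : ℤ × ℤ) : branchHom b (shift u) = shift (b.scale * u) := by
  ext p
  · by_cases hp : ∃ v, b.eval v = p
    · obtain ⟨v, rfl⟩ := hp
      rw [branchHom_lit_eval]; rfl
    · exact branchHom_lit_of_not b _ hp
  · rfl
  · rfl

theorem branchHom_lamp : branchHom b (lamp ((), 0)) = lamp (b.state, b.shift) := by
  classical
  ext p
  · by_cases hp : ∃ v, b.eval v = p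
    · obtain ⟨v, rfl⟩ := hp
      have : b.eval v = (b.state, b.shift) ↔ v = 0 := by
        rw [← b.eval_injective.eq_iff]; simp [Branch.eval]
      rw [branchHom_lit_eval]
      simp [lamp, Pi.single_apply, this]
    · have : p ≠ (b.state, b.shift) := by
        rintro rfl; exact hp ⟨0, by simp [Branch.eval]⟩
      refine (branchHom_lit_of_not b _ hp).trans ?_
      simp [lamp, this]
  · change (b.scale * 0).1 = 0; simp
  · change (b.scale * 0).2 = 0; simp

end Lamp

open HNNExtension NormalWord in
theorem HNNExtension.exists_reducedWord_of_mem_closure {K : Type} [Group K] {A B : Subgroup K}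
    {φ : A ≃* B} {H : Subgroup K} (hH : ∀ a : A, (a : K) ∈ H ↔ (φ a : K) ∈ H)
    {x : HNNExtension K A B φ} (hx : x ∈ Subgroup.closure (insert t (of '' (H : Set K)))) :
    ∃ w : ReducedWord K A B, w.prod φ = x ∧ w.head ∈ H ∧ ∀ p ∈ w.toList, p.2 ∈ H := by
  have step (u : ℤˣ) (y : HNNExtension K A B φ)
      (hy : ∃ w : ReducedWord K A B, w.prod φ = y ∧ w.head ∈ H ∧ ∀ p ∈ w.toList, p.2 ∈ H) :
      ∃ w : ReducedWord K A B, w.prod φ = t ^ (u : ℤ) * y ∧ w.head ∈ H ∧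
        ∀ p ∈ w.toList, p.2 ∈ H := by
    obtain ⟨⟨g, l, hl⟩, rfl, hg, hmem⟩ := hy
    by_cases hc : g ∈ toSubgroup A B u ∧ ∃ g' l', l = (-u, g') :: l'
    · obtain ⟨hgu, g', l', rfl⟩ := hc
      obtain ⟨g₂, hg₂, heq⟩ : ∃ g₂ ∈ H,
          (t ^ (u : ℤ) * of g * t ^ ((-u : ℤˣ) : ℤ) : HNNExtension K A B φ) = of g₂ := by
        rcases Int.units_eq_one_or u with rfl | rfl
        · refine ⟨φ ⟨g, hgu⟩, (hH ⟨g, hgu⟩).1 hg, ?_⟩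
          simp [equiv_eq_conj]
        · refine ⟨φ.symm ⟨g, hgu⟩, (hH _).2 (by simpa using hg), ?_⟩
          simp [equiv_symm_eq_conj]
      refine ⟨⟨g₂ * g', l', (List.isChain_cons.1 hl).2⟩, ?_, ?_, ?_⟩
      · simp only [ReducedWord.prod, map_mul, ← heq, List.map_cons, List.prod_cons, mul_assoc]
      · exact mul_mem hg₂ (hmem _ List.mem_cons_self)
      · exact fun p hp => hmem p (List.mem_cons_of_mem _ hp)
    · refine ⟨⟨1, (u, g) :: l, List.isChain_cons.2 ⟨?_, hl⟩⟩, ?_, one_mem _, ?_⟩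
      · rintro ⟨v, g'⟩ hv hgu
        obtain ⟨l', rfl⟩ : ∃ l', l = (v, g') :: l' := by
          cases l <;> simp_all
        by_contra hne
        refine hc ⟨hgu, g', l', ?_⟩
        rw [show v = -u from (Int.units_ne_iff_eq_neg.1 (Ne.symm hne))]
      · simp [ReducedWord.prod, mul_assoc]
      · simpa using ⟨hg, fun a b h => hmem (a, b) h⟩
  have step' (h : K) (hh : h ∈ H) (y : HNNExtension K A B φ)
      (hy : ∃ w : ReducedWord K A B, w.prod φ = y ∧ w.head ∈ H ∧ ∀ p ∈ w.toList, p.2 ∈ H) :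
      ∃ w : ReducedWord K A B, w.prod φ = of h * y ∧ w.head ∈ H ∧ ∀ p ∈ w.toList, p.2 ∈ H := by
    obtain ⟨⟨g, l, hl⟩, rfl, hg, hmem⟩ := hy
    exact ⟨⟨h * g, l, hl⟩, by simp [ReducedWord.prod, mul_assoc], mul_mem hh hg, hmem⟩
  induction hx using Subgroup.closure_induction_left with
  | one => exact ⟨ReducedWord.empty K A B, by simp [ReducedWord.prod], one_mem _, by simp⟩
  | mul_left x hx y _ ih =>
    rcases hx with rfl | ⟨h, hh, rfl⟩
    · simpa using step 1 y ih
    · exact step' h hh y ih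
  | inv_mul_cancel x hx y _ ih =>
    rcases hx with rfl | ⟨h, hh, rfl⟩
    · simpa using step (-1) y ih
    · simpa using step' h⁻¹ (inv_mem hh) y ih

theorem exists_conjugator {K P : Type} [Group K] [Group P] (H : Subgroup K) {α β : P →* K}
    (hα : Function.Injective α) (hβ : Function.Injective β) (hH : ∀ p, α p ∈ H ↔ β p ∈ H) :
    ∃ (G : Type) (_ : Group G) (ι : K →* G) (H' : Subgroup G), Function.Injective ι ∧
      H'.comap ι = H ∧ ∃ r ∈ H', ∀ p, r * ι (α p) = ι (β p) * r := by
  let φ : α.range ≃* β.range :=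
    (MonoidHom.ofInjective hα).symm.trans (MonoidHom.ofInjective hβ)
  have hφ (p : P) : φ ⟨α p, p, rfl⟩ = ⟨β p, p, rfl⟩ := by
    have : (⟨α p, p, rfl⟩ : α.range) = MonoidHom.ofInjective hα p := rfl
    rw [this]
    simp only [φ, MulEquiv.trans_apply, MulEquiv.symm_apply_apply]
    rfl
  refine ⟨HNNExtension K α.range β.range φ, inferInstance, HNNExtension.of,
    Subgroup.closure (insert HNNExtension.t (HNNExtension.of '' (H : Set K))),
    HNNExtension.of_injective φ, ?_, HNNExtension.t,
    Subgroup.subset_closure (Set.mem_insert _ _), fun p => ?_⟩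
  · refine le_antisymm (fun g hg => ?_) fun g hg =>
      Subgroup.subset_closure (Set.mem_insert_of_mem _ ⟨g, hg, rfl⟩)
    obtain ⟨w, hw, hhead, -⟩ := HNNExtension.exists_reducedWord_of_mem_closure (φ := φ)
      (by rintro ⟨_, p, rfl⟩; rw [hφ]; exact hH p) hg
    have hnil := HNNExtension.ReducedWord.toList_eq_nil_of_mem_of_range φ w ⟨g, hw.symm⟩
    have : w.head = g := HNNExtension.of_injective φ (by
      rw [← hw]; simp [HNNExtension.NormalWord.ReducedWord.prod, hnil])
    rwa [← this]
  · have := HNNExtension.t_mul_of (φ := φ) ⟨α p, p, rfl⟩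
    rwa [hφ] at this

theorem exists_conjugators {ι P : Type} [Finite ι] [Group P] {K : Type} [Group K]
    (H : Subgroup K) {α β : ι → P →* K} (hα : ∀ i, Function.Injective (α i))
    (hβ : ∀ i, Function.Injective (β i)) (hH : ∀ i p, α i p ∈ H ↔ β i p ∈ H) :
    ∃ (G : Type) (_ : Group G) (j : K →* G) (H' : Subgroup G), Function.Injective j ∧
      H'.comap j = H ∧ ∃ r : ι → G, (∀ i, r i ∈ H') ∧ ∀ i p, r i * j (α i p) = j (β i p) * r i := by
  suffices key : ∀ (l : List ι) (K : Type) [Group K] (H : Subgroup K) (α β : ι → P →* K),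
      (∀ i, Function.Injective (α i)) → (∀ i, Function.Injective (β i)) →
      (∀ i p, α i p ∈ H ↔ β i p ∈ H) →
      ∃ (G : Type) (_ : Group G) (j : K →* G) (H' : Subgroup G), Function.Injective j ∧
        H'.comap j = H ∧ ∀ i ∈ l, ∃ r ∈ H', ∀ p, r * j (α i p) = j (β i p) * r by
    have := Fintype.ofFinite ι
    obtain ⟨G, _, j, H', hj, hH', h⟩ := key Finset.univ.toList K H α β hα hβ hH
    choose r hr using fun i => h i (by simp)
    exact ⟨G, _, j, H', hj, hH', r, fun i => (hr i).1, fun i => (hr i).2⟩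
  intro l
  induction l with
  | nil => exact fun K _ H α β _ _ _ => ⟨K, _, MonoidHom.id K, H, fun _ _ h => h, rfl, by simp⟩
  | cons i l ih =>
    intro K _ H α β hα hβ hH
    obtain ⟨K₁, _, j₁, H₁, hj₁, hH₁, r, hr, hrel⟩ := exists_conjugator H (hα i) (hβ i) (hH i)
    have hmem (x : K) : j₁ x ∈ H₁ ↔ x ∈ H := by rw [← hH₁]; rfl
    obtain ⟨G, _, j, H', hj, hH', h⟩ := ih K₁ H₁ (fun i => j₁.comp (α i)) (fun i => j₁.comp (β i))
      (fun i => hj₁.comp (hα i)) (fun i => hj₁.comp (hβ i))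
      (fun i p => (hmem _).trans ((hH i p).trans (hmem _).symm))
    refine ⟨G, _, j.comp j₁, H', hj.comp hj₁, ?_, fun i' hi' => ?_⟩
    · rw [← Subgroup.comap_comap, hH', hH₁]
    · rcases List.mem_cons.1 hi' with rfl | hi'
      · refine ⟨j r, ?_, fun p => ?_⟩
        · rwa [← hH'] at hr
        · simp only [MonoidHom.comp_apply, ← map_mul, hrel]
      · exact h i' hi'

/-- A property of tuples of group elements which is expressed by finitely many relators. -/
def IsFinitelyRelated {α : Type} (Q : ∀ (G : Type) [Group G], (α → G) → Prop) : Prop :=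
  ∃ C : List (FreeGroup α), ∀ (G : Type) [Group G] (v : α → G),
    Q G v ↔ ∀ r ∈ C, FreeGroup.lift v r = 1

namespace IsFinitelyRelated

variable {α : Type}

theorem eq (a b : FreeGroup α) :
    IsFinitelyRelated fun G _ (v : α → G) => FreeGroup.lift v a = FreeGroup.lift v b :=
  ⟨[a * b⁻¹], fun G _ v => by simp [mul_inv_eq_one]⟩

theorem and {Q Q' : ∀ (G : Type) [Group G], (α → G) → Prop} (h : IsFinitelyRelated Q)
    (h' : IsFinitelyRelated Q') : IsFinitelyRelated fun G _ v => Q G v ∧ Q' G v := by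
  obtain ⟨C, hC⟩ := h
  obtain ⟨C', hC'⟩ := h'
  exact ⟨C ++ C', fun G _ v => by simp only [hC, hC', List.forall_mem_append]⟩

theorem all {ι : Type} [Finite ι] {Q : ι → ∀ (G : Type) [Group G], (α → G) → Prop}
    (h : ∀ i, IsFinitelyRelated (Q i)) : IsFinitelyRelated fun G _ v => ∀ i, Q i G v := by
  have := Fintype.ofFinite ι
  choose C hC using h
  refine ⟨Finset.univ.toList.flatMap C, fun G _ v => ?_⟩
  simp only [hC, List.mem_flatMap, Finset.mem_toList, Finset.mem_univ, true_and]
  exact ⟨fun H r ⟨i, hr⟩ => H i r hr, fun H i r hr => H r ⟨i, hr⟩⟩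

end IsFinitelyRelated

/-- Generators of the group simulating an affine rule system. -/
inductive MachineGen (σ ι : Type)
  | x
  | y
  | key
  | start
  | lamp (s : σ)
  | conj (i : ι)

namespace MachineGen

open Relation

variable {σ ι : Type}

instance [Finite σ] [Finite ι] : Finite (MachineGen σ ι) :=
  Finite.of_injective (β := Fin 4 ⊕ σ ⊕ ι)
    (fun
      | x => .inl 0
      | y => .inl 1
      | key => .inl 2
      | start => .inl 3
      | lamp s => .inr (.inl s)
      | conj i => .inr (.inr i))
    (by rintro (_ | _ | _ | _ | s | i) (_ | _ | _ | _ | s' | i') h <;> simp_all)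

/-- The conjugate of the lamp generator for the state of `p` by the translation to `p`. -/
def lampAt {G : Type} [Group G] (v : MachineGen σ ι → G) (p : σ × (ℤ × ℤ)) : G :=
  v x ^ p.2.1 * v y ^ p.2.2 * v (lamp p.1) * (v x ^ p.2.1 * v y ^ p.2.2)⁻¹

theorem map_lampAt {G K : Type} [Group G] [Group K] (φ : G →* K) (v : MachineGen σ ι → G)
    (p : σ × (ℤ × ℤ)) : φ (lampAt v p) = lampAt (fun a => φ (v a)) p := by
  simp [lampAt]

/-- The relations of the group simulating an affine rule system with final state `h`. -/
def IsModel (rule : ι → Branch σ × Branch σ) (h : σ) (G : Type) [Group G]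
    (v : MachineGen σ ι → G) : Prop :=
  v x * v y = v y * v x ∧ v key * v (lamp h) = v (lamp h) * v key ∧
  ∀ i, v key * v (conj i) = v (conj i) * v key ∧
    v (conj i) * v x ^ (rule i).1.scale.1 = v x ^ (rule i).2.scale.1 * v (conj i) ∧
    v (conj i) * v y ^ (rule i).1.scale.2 = v y ^ (rule i).2.scale.2 * v (conj i) ∧
    v (conj i) * lampAt v ((rule i).1.state, (rule i).1.shift) =
      lampAt v ((rule i).2.state, (rule i).2.shift) * v (conj i)

theorem isFinitelyRelated_isModel [Finite ι] (rule : ι → Branch σ × Branch σ) (h : σ) :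
    IsFinitelyRelated (IsModel rule h) := by
  have key (a b : FreeGroup (MachineGen σ ι)) := IsFinitelyRelated.eq a b
  refine .and ?_ (.and ?_ (.all fun i => .and ?_ (.and ?_ (.and ?_ ?_))))
  · simpa using key (.of x * .of y) (.of y * .of x)
  · simpa using key (.of .key * .of (lamp h)) (.of (lamp h) * .of .key)
  · simpa using key (.of .key * .of (conj i)) (.of (conj i) * .of .key)
  · simpa using key (.of (conj i) * .of x ^ (rule i).1.scale.1)
      (.of x ^ (rule i).2.scale.1 * .of (conj i))
  · simpa using key (.of (conj i) * .of y ^ (rule i).1.scale.2)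
      (.of y ^ (rule i).2.scale.2 * .of (conj i))
  · have := key (.of (conj i) * lampAt FreeGroup.of ((rule i).1.state, (rule i).1.shift))
      (lampAt FreeGroup.of ((rule i).2.state, (rule i).2.shift) * .of (conj i))
    simpa only [map_mul, map_lampAt, FreeGroup.lift_apply_of] using this

theorem lampAt_eval {G : Type} [Group G] {v : MachineGen σ ι → G} (hxy : Commute (v x) (v y))
    (b : Branch σ) (u : ℤ × ℤ) :
    lampAt v (b.eval u) = (v x ^ b.scale.1) ^ u.1 * (v y ^ b.scale.2) ^ u.2 *
      lampAt v (b.state, b.shift) * ((v x ^ b.scale.1) ^ u.1 * (v y ^ b.scale.2) ^ u.2)⁻¹ := by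
  have : v x ^ (b.eval u).2.1 * v y ^ (b.eval u).2.2 =
      (v x ^ b.scale.1) ^ u.1 * (v y ^ b.scale.2) ^ u.2 * (v x ^ b.shift.1 * v y ^ b.shift.2) := by
    simp only [Branch.eval, Prod.fst_add, Prod.fst_mul, Prod.snd_add, Prod.snd_mul, zpow_add,
      zpow_mul]
    have h := ((hxy.zpow_left b.shift.1).zpow_right b.scale.2).zpow_right u.2
    simp only [mul_assoc, h.left_comm]
  rw [lampAt, this]
  simp only [lampAt, Branch.eval, mul_inv_rev, mul_assoc]

theorem commute_key_lampAt {rule : ι → Branch σ × Branch σ} {h : σ} {G : Type} [Group G]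
    {v : MachineGen σ ι → G} (hv : IsModel rule h G v) {p q : σ × (ℤ × ℤ)}
    (hpq : EqvGen (AffineStep rule) p q) :
    Commute (v key) (lampAt v p) ↔ Commute (v key) (lampAt v q) := by
  obtain ⟨hxy, -, hrule⟩ := hv
  induction hpq with
  | refl => rfl
  | symm _ _ _ ih => exact ih.symm
  | trans _ _ _ _ _ ih₁ ih₂ => exact ih₁.trans ih₂
  | rel p q hpq =>
    obtain ⟨i, u, rfl, rfl⟩ := hpq
    obtain ⟨hkey, hx, hy, hlamp⟩ := hrule i
    have hconj : SemiconjBy (v (conj i)) (lampAt v ((rule i).1.eval u))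
        (lampAt v ((rule i).2.eval u)) := by
      rw [lampAt_eval hxy, lampAt_eval hxy]
      have hx' : SemiconjBy (v (conj i)) _ _ := hx
      have hy' : SemiconjBy (v (conj i)) _ _ := hy
      have h := (hx'.zpow_right u.1).mul_right (hy'.zpow_right u.2)
      exact (h.mul_right hlamp).mul_right h.inv_right
    have hkey' : v (conj i) * v key * (v (conj i))⁻¹ = v key := by
      rw [← hkey, mul_inv_cancel_right]
    have hlamp' := eq_mul_inv_of_mul_eq hconj.eq.symm
    rw [← Commute.conj_iff (v (conj i)), hkey', ← hlamp']

end MachineGen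

section Commutator

open scoped commutatorElement

theorem exists_commute_iff_mem {G : Type} [Group G] (H : Subgroup G) :
    ∃ (M : Type) (_ : Group M) (ρ : G →* M) (k : M), (∀ g ∈ H, Commute k (ρ g)) ∧
      ∀ g ∉ H, orderOf ⁅k, ρ g⁆ = 0 := by
  classical
  let ρ : G →* Equiv.Perm ((G ⧸ H) × ℤ) := MonoidHom.mk'
    (fun g => (MulAction.toPerm g).prodCongr (Equiv.refl ℤ))
    (fun a b => by ext ⟨c, i⟩ <;> simp [mul_smul])
  let k : Equiv.Perm ((G ⧸ H) × ℤ) :=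
    Equiv.prodShear (Equiv.refl _) fun c => if c = (1 : G) then Equiv.addRight 1 else Equiv.refl ℤ
  have hρ (g : G) (c : G ⧸ H) (i : ℤ) : ρ g (c, i) = (g • c, i) := rfl
  have hk (c : G ⧸ H) (i : ℤ) : k (c, i) = (c, if c = (1 : G) then i + 1 else i) := by
    by_cases hc : c = (1 : G) <;> simp [k, hc]
  have hmem (g : G) : g • ((1 : G) : G ⧸ H) = (1 : G) ↔ g ∈ H := by
    rw [MulAction.Quotient.smul_coe, QuotientGroup.eq]; simp
  refine ⟨_, _, ρ, k, fun g hg => ?_, fun g hg => ?_⟩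
  · refine Equiv.ext fun ⟨c, i⟩ => ?_
    have : g • c = (1 : G) ↔ c = (1 : G) := by
      nth_rw 1 [← (hmem g).2 hg]
      exact smul_left_cancel_iff g
    simp [hρ, hk, this]
  · have hstep (i : ℤ) : ⁅k, ρ g⁆ (((1 : G) : G ⧸ H), i) = (((1 : G) : G ⧸ H), i + 1) := by
      have h₁ : (ρ g)⁻¹ (((1 : G) : G ⧸ H), i) = (g⁻¹ • ((1 : G) : G ⧸ H), i) := by
        rw [← map_inv, hρ]
      have h₂ : k⁻¹ (g⁻¹ • ((1 : G) : G ⧸ H), i) = (g⁻¹ • ((1 : G) : G ⧸ H), i) := by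
        rw [Equiv.Perm.inv_eq_iff_eq, hk, if_neg]
        rwa [hmem, inv_mem_iff]
      rw [commutatorElement_def, Equiv.Perm.mul_apply, Equiv.Perm.mul_apply, Equiv.Perm.mul_apply,
        h₁, h₂, hρ, smul_inv_smul, hk, if_pos rfl]
    have hpow (n : ℕ) : (⁅k, ρ g⁆ ^ n) (((1 : G) : G ⧸ H), 0) = (((1 : G) : G ⧸ H), (n : ℤ)) := by
      induction n with
      | zero => rfl
      | succ n ih => rw [pow_succ', Equiv.Perm.mul_apply, ih, hstep]; simp
    refine orderOf_eq_zero_iff'.2 fun n hn h => ?_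
    have := hpow n
    rw [h] at this
    simp [Prod.ext_iff] at this
    omega

namespace MachineGen

open Relation

variable {σ ι : Type}

theorem exists_isModel [Finite ι] (rule : ι → Branch σ × Branch σ) (h : σ) {p : σ × (ℤ × ℤ)}
    (hp : ¬ EqvGen (AffineStep rule) p (h, 0)) :
    ∃ (M : Type) (_ : Group M) (v : MachineGen σ ι → M), IsModel rule h M v ∧
      v start = lampAt v p ∧ orderOf ⁅v key, v start⁆ = 0 := by
  let Z : Set (σ × (ℤ × ℤ)) := {q | EqvGen (AffineStep rule) q (h, 0)}
  have hZ (i : ι) (u : ℤ × ℤ) : (rule i).1.eval u ∈ Z ↔ (rule i).2.eval u ∈ Z :=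
    have hrel := EqvGen.rel (r := AffineStep rule) _ _ ⟨i, u, rfl, rfl⟩
    ⟨fun H => .trans _ _ _ (.symm _ _ hrel) H, fun H => .trans _ _ _ hrel H⟩
  obtain ⟨G, _, j, H, -, hH, r, hrH, hr⟩ := exists_conjugators (Lamp.supported Z)
    (α := fun i => Lamp.branchHom (rule i).1) (β := fun i => Lamp.branchHom (rule i).2)
    (fun i => Lamp.branchHom_injective _) (fun i => Lamp.branchHom_injective _)
    (fun i f => by simp only [Lamp.branchHom_mem_supported, hZ])
  have hmem (q : σ × (ℤ × ℤ)) : j (Lamp.lamp q) ∈ H ↔ q ∈ Z := by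
    rw [← Lamp.lamp_mem_supported, ← hH]; rfl
  obtain ⟨M, _, ρ, k, hk, hk'⟩ := exists_commute_iff_mem H
  let v : MachineGen σ ι → M
    | x => ρ (j (Lamp.shift (1, 0)))
    | y => ρ (j (Lamp.shift (0, 1)))
    | key => k
    | start => ρ (j (Lamp.lamp p))
    | lamp s => ρ (j (Lamp.lamp (s, 0)))
    | conj i => ρ (r i)
  have hx (n : ℤ) : v x ^ n = ρ (j (Lamp.shift (n, 0))) := by
    simp only [v, ← map_zpow, Lamp.shift_zpow]; simp
  have hy (n : ℤ) : v y ^ n = ρ (j (Lamp.shift (0, n))) := by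
    simp only [v, ← map_zpow, Lamp.shift_zpow]; simp
  have hlamp (q : σ × (ℤ × ℤ)) : lampAt v q = ρ (j (Lamp.lamp q)) := by
    have : v (lamp q.1) = ρ (j (Lamp.lamp (q.1, 0))) := rfl
    simp only [lampAt, hx, hy, this, ← map_mul, ← map_inv, Lamp.shift_mul, Lamp.shift_conj_lamp]
    simp
  refine ⟨M, _, v, ⟨?_, ?_, fun i => ⟨?_, ?_, ?_, ?_⟩⟩, (hlamp p).symm, hk' _ ?_⟩
  · simp only [v, ← map_mul, Lamp.shift_mul]; simp
  · exact hk _ ((hmem _).2 (.refl _))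
  · exact hk _ (hrH i)
  · have := hr i (Lamp.shift (1, 0))
    simp only [Lamp.branchHom_shift] at this
    simpa [hx, v, Prod.mul_def] using congrArg ρ this
  · have := hr i (Lamp.shift (0, 1))
    simp only [Lamp.branchHom_shift] at this
    simpa [hy, v, Prod.mul_def] using congrArg ρ this
  · have := hr i (Lamp.lamp ((), 0))
    simp only [Lamp.branchHom_lamp] at this
    simpa [hlamp, v] using congrArg ρ this
  · exact fun H => hp ((hmem p).1 H)

end MachineGen

theorem exists_relators_of_partrec {f : ℕ →. ℕ} (hf : Nat.Partrec f) :
    ∃ (β : Type) (_ : Finite β) (Q : ∀ (G : Type) [Group G], (β → G) → Prop) (y s k a : β)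
      (R : ℕ → ℕ), IsFinitelyRelated Q ∧ Primrec R ∧ ∀ n,
        ((f n).Dom → ∀ (G : Type) [Group G] (v : β → G), Q G v →
          v a = v y ^ R n * v s * (v y ^ R n)⁻¹ → ⁅v k, v a⁆ = 1) ∧
        (¬ (f n).Dom → ∃ (G : Type) (_ : Group G) (v : β → G), Q G v ∧
          v a = v y ^ R n * v s * (v y ^ R n)⁻¹ ∧ orderOf ⁅v k, v a⁆ = 0) := by
  obtain ⟨σ, ι, _, _, rule, s, h, R, hR, hdom⟩ := exists_affine_system hf
  have hstart (n : ℕ) {G : Type} [Group G] (v : MachineGen σ ι → G) :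
      MachineGen.lampAt v (s, (0, (R n : ℤ))) =
        v .y ^ R n * v (.lamp s) * (v .y ^ R n)⁻¹ := by
    simp [MachineGen.lampAt]
  refine ⟨MachineGen σ ι, inferInstance, MachineGen.IsModel rule h, .y, .lamp s, .key, .start, R,
    MachineGen.isFinitelyRelated_isModel rule h, hR, fun n => ⟨fun hn G _ v hv ha => ?_,
    fun hn => ?_⟩⟩
  · rw [← hstart] at ha
    rw [commutatorElement_eq_one_iff_commute, ha,
      MachineGen.commute_key_lampAt hv ((hdom n).1 hn)]
    have : MachineGen.lampAt v (h, 0) = v (.lamp h) := by simp [MachineGen.lampAt]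
    rw [this]
    exact hv.2.1
  · obtain ⟨G, _, v, hv, ha, horder⟩ := MachineGen.exists_isModel rule h (mt (hdom n).2 hn)
    exact ⟨G, _, v, hv, by rw [ha, hstart], horder⟩

end Commutator

theorem IsFinitelyRelated.comap {α β : Type} {Q : ∀ (G : Type) [Group G], (β → G) → Prop}
    (h : IsFinitelyRelated Q) (φ : β → α) :
    IsFinitelyRelated fun G _ (v : α → G) => Q G fun b => v (φ b) := by
  obtain ⟨C, hC⟩ := h
  refine ⟨C.map (FreeGroup.map φ), fun G _ v => ?_⟩
  have hlift (r : FreeGroup β) :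
      FreeGroup.lift v (FreeGroup.map φ r) = FreeGroup.lift (fun b => v (φ b)) r :=
    DFunLike.congr_fun (f := (FreeGroup.lift v).comp (FreeGroup.map φ)) (by ext; simp) r
  simp only [hC, List.forall_mem_map, hlift]

/-- Generators of the group obtained from a group generated by `β` by adding elements which make
the whole group collapse as soon as a given commutator is trivial. -/
inductive CollapseGen (β : Type)
  | base (b : β)
  | shift
  | mul
  | conj (j : β ⊕ Bool)
  | link

namespace CollapseGen

open scoped commutatorElement

variable {β : Type}

instance [Finite β] : Finite (CollapseGen β) :=
  Finite.of_injective (β := Fin 3 ⊕ β ⊕ β ⊕ Bool)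
    (fun
      | shift => .inl 0
      | mul => .inl 1
      | link => .inl 2
      | base b => .inr (.inl b)
      | conj j => .inr (.inr j))
    (by rintro (b | _ | _ | j | _) (b' | _ | _ | j' | _) h <;> simp_all)

/-- The elements which are made conjugate to the commutator. -/
def target {G : Type} [Group G] (v : CollapseGen β → G) : β ⊕ Bool → G
  | .inl b => v (base b) * v shift
  | .inr false => v shift
  | .inr true => v mul

/-- The relations making the group collapse when the commutator of `k` and `a` is trivial. -/
def IsCollapsing (idx : β ⊕ Bool → ℕ) (k a : β) (G : Type) [Group G] (v : CollapseGen β → G) :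
    Prop :=
  ∀ j, v (conj j) * ⁅v (base k), v (base a)⁆ = target v j * v (conj j) ∧
    v link * v shift ^ idx j * v mul = v (conj j) * v link * v shift ^ idx j

theorem isFinitelyRelated_isCollapsing [Finite β] (idx : β ⊕ Bool → ℕ) (k a : β) :
    IsFinitelyRelated (IsCollapsing idx k a) := by
  have key (a b : FreeGroup (CollapseGen β)) := IsFinitelyRelated.eq a b
  refine .all fun j => .and ?_ ?_
  · have := key (.of (conj j) * ⁅FreeGroup.of (base k), FreeGroup.of (base a)⁆)
      (target FreeGroup.of j * .of (conj j))
    rcases j with _ | _ | _ <;>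
      simpa only [target, map_commutatorElement, map_mul, FreeGroup.lift_apply_of] using this
  · simpa only [map_mul, map_pow, FreeGroup.lift_apply_of] using
      key (.of link * .of shift ^ idx j * .of mul) (.of (conj j) * .of link * .of shift ^ idx j)

theorem commute_of_isCollapsing {idx : β ⊕ Bool → ℕ} {k a : β} {G : Type} [Group G]
    {v : CollapseGen β → G} (hv : IsCollapsing idx k a G v)
    (hc : ⁅v (base k), v (base a)⁆ = 1) (g g' : CollapseGen β) : Commute (v g) (v g') := by
  have htarget (j) : target v j = 1 := by simpa [hc] using (hv j).1
  have hshift : v shift = 1 := htarget (.inr false)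
  have hmul : v mul = 1 := htarget (.inr true)
  have hbase (b) : v (base b) = 1 := by simpa [target, hshift] using htarget (.inl b)
  have hconj (j) : v (conj j) = 1 := by simpa [hshift, hmul] using (hv j).2
  have key (g) : v g = 1 ∨ v g = v link := by cases g <;> simp [*]
  rcases key g with h | h <;> rcases key g' with h' | h' <;> simp [h, h']

theorem exists_isCollapsing [Finite β] {idx : β ⊕ Bool → ℕ} (hidx : Function.Injective idx)
    {k a : β} {M : Type} [Group M] (u : β → M) (hu : orderOf ⁅u k, u a⁆ = 0) :
    ∃ (G : Type) (_ : Group G) (j : M →* G) (v : CollapseGen β → G), (∀ b, v (base b) = j (u b)) ∧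
      IsCollapsing idx k a G v ∧ ¬ Commute (v shift) (v mul) := by
  let F : Equiv.Perm (FreeGroup ℤ) := (FreeGroup.freeGroupCongr (Equiv.addRight (1 : ℤ))).toEquiv
  let L : FreeGroup ℤ →* Equiv.Perm (FreeGroup ℤ) := MulAction.toPermHom _ _
  have hFL (x : FreeGroup ℤ) : F * L x = L (F x) * F := by
    refine Equiv.ext fun y => ?_
    exact map_mul (FreeGroup.freeGroupCongr (Equiv.addRight (1 : ℤ))) x y
  have hFof (n : ℤ) : F (.of n) = .of (n + 1) := rfl
  have hFLpow (n : ℕ) : F ^ n * L (.of 0) * (F ^ n)⁻¹ = L (.of (n : ℤ)) := by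
    rw [mul_inv_eq_iff_eq_mul]
    induction n with
    | zero => simp
    | succ n ih => rw [pow_succ', mul_assoc, ih, ← mul_assoc, hFL, hFof, mul_assoc]; simp
  let i₁ : M →* M × Equiv.Perm (FreeGroup ℤ) := MonoidHom.inl _ _
  let i₂ : Equiv.Perm (FreeGroup ℤ) →* M × Equiv.Perm (FreeGroup ℤ) := MonoidHom.inr _ _
  let e : β ⊕ Bool → M × Equiv.Perm (FreeGroup ℤ)
    | .inl b => i₁ (u b) * i₂ F
    | .inr false => i₂ F
    | .inr true => i₂ (L (.of 0))
  have hinf {G : Type} [Group G] {g : G} (hg : orderOf g = 0) :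
      Function.Injective (zpowersHom G g) :=
    injective_zpow_iff_not_isOfFinOrder.2 (orderOf_eq_zero_iff.1 hg)
  have hlift {G G' : Type} [Group G] [Group G'] (φ : G →* G') {g : G} (hg : orderOf (φ g) = 0) :
      orderOf g = 0 := by
    simpa [hg] using orderOf_map_dvd φ g
  have hbot {P G : Type} [Group P] [Group G] {φ ψ : P →* G} (hφ : Function.Injective φ)
      (hψ : Function.Injective ψ) (p : P) :
      φ p ∈ (⊥ : Subgroup G) ↔ ψ p ∈ (⊥ : Subgroup G) := by
    rw [Subgroup.mem_bot, Subgroup.mem_bot, map_eq_one_iff _ hφ, map_eq_one_iff _ hψ]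
  have hinl (G G' : Type) [Group G] [Group G'] : Function.Injective (MonoidHom.inl G G') :=
    Prod.mk_left_injective _
  have hinr (G G' : Type) [Group G] [Group G'] : Function.Injective (MonoidHom.inr G G') :=
    Prod.mk_right_injective _
  have hF : orderOf F = 0 := by
    have hpow (n : ℕ) : (F ^ n) (.of 0) = .of (n : ℤ) := by
      induction n with
      | zero => rfl
      | succ n ih => rw [pow_succ', Equiv.Perm.mul_apply, ih, hFof]; simp
    refine orderOf_eq_zero_iff'.2 fun n hn h => hn.ne' ?_
    have := hpow n
    rw [h] at this
    exact_mod_cast (FreeGroup.of_injective this).symm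
  have hLinj : Function.Injective L := MulAction.toPerm_injective
  have hL : orderOf (L (.of 0)) = 0 := by
    rw [orderOf_injective L hLinj]
    exact orderOf_eq_zero_iff.2 (not_isOfFinOrder_of_isMulTorsionFree (FreeGroup.of_ne_one _))
  have he (j) : orderOf (e j) = 0 := by
    refine hlift (MonoidHom.snd _ _) ?_
    rcases j with b | _ | _
    · simpa [e, i₁, i₂] using hF
    · exact hF
    · exact hL
  have hc : orderOf ⁅i₁ (u k), i₁ (u a)⁆ = 0 :=
    hlift (MonoidHom.fst _ _) (by simpa [i₁, map_commutatorElement] using hu)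
  obtain ⟨G₁, _, j₁, -, hj₁, -, y, -, hy⟩ := exists_conjugators (⊥ : Subgroup _)
    (fun _ : β ⊕ Bool => hinf hc) (fun j => hinf (he j)) fun j => hbot (hinf hc) (hinf (he j))
  replace hy (i) := hy i (.ofAdd 1)
  simp only [zpowersHom_apply, toAdd_ofAdd, zpow_one] at hy
  let α : FreeGroup (β ⊕ Bool) →* G₁ × FreeGroup (β ⊕ Bool) :=
    FreeGroup.lift fun i => (j₁ (i₂ (L (.of (idx i : ℤ)))), 1)
  let γ : FreeGroup (β ⊕ Bool) →* G₁ × FreeGroup (β ⊕ Bool) :=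
    FreeGroup.lift fun i => (y i, .of i)
  have hα : Function.Injective α := by
    have : α = (((MonoidHom.inl _ _).comp j₁).comp i₂).comp
        (L.comp (FreeGroup.map fun i => (idx i : ℤ))) := by ext <;> simp [α]
    rw [this]
    exact (((hinl _ _).comp hj₁).comp (hinr _ _)).comp
      (hLinj.comp (FreeGroup.map_injective (Nat.cast_injective.comp hidx)))
  have hγ : Function.Injective γ := by
    have : (MonoidHom.snd _ _).comp γ = MonoidHom.id _ := by ext; simp [γ]
    exact Function.LeftInverse.injective (g := Prod.snd) (DFunLike.congr_fun this)
  obtain ⟨G, _, j₂, -, hj₂, -, z, -, hz⟩ := exists_conjugator (⊥ : Subgroup _) hα hγ (hbot hα hγ)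
  replace hz (i) := hz (.of i)
  simp only [α, γ, FreeGroup.lift_apply_of] at hz
  let j := j₂.comp ((MonoidHom.inl _ _).comp j₁)
  have hj : Function.Injective j := hj₂.comp ((hinl _ _).comp hj₁)
  let v : CollapseGen β → G
    | base b => j (i₁ (u b))
    | shift => j (i₂ F)
    | mul => j (i₂ (L (.of 0)))
    | conj i => j₂ (y i, .of i)
    | link => z
  refine ⟨G, _, j.comp i₁, v, fun b => rfl, fun i => ⟨?_, ?_⟩, fun h => ?_⟩
  · have htarget : target v i = j (e i) := by
      rcases i with _ | _ | _ <;> simp [target, v, e]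
    rw [htarget]
    simp only [v, ← map_commutatorElement]
    change j₂ _ * j₂ _ = j₂ _ * j₂ _
    rw [← map_mul, ← map_mul]
    exact congrArg j₂ (Prod.ext (hy i) ((mul_one _).trans (one_mul _).symm))
  · have : j (i₂ F) ^ idx i * j (i₂ (L (.of 0))) * (j (i₂ F) ^ idx i)⁻¹ =
        j (i₂ (L (.of (idx i : ℤ)))) := by
      rw [← hFLpow]; simp only [map_mul, map_inv, map_pow]
    change z * j (i₂ F) ^ idx i * j (i₂ (L (.of 0))) = j₂ (y i, .of i) * z * j (i₂ F) ^ idx i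
    rw [← hz, ← mul_inv_eq_iff_eq_mul, mul_assoc, mul_assoc, ← mul_assoc (_ ^ _), this]
    rfl
  · have h' : j (i₂ (F * L (.of 0))) = j (i₂ (L (.of 0) * F)) := by
      simp only [map_mul]; exact h
    have h₂ := hinr _ _ (hj h')
    rw [hFL, mul_left_inj] at h₂
    have := FreeGroup.of_injective (hLinj h₂)
    simp at this

end CollapseGen

theorem exists_collapsing_relators_of_partrec {f : ℕ →. ℕ} (hf : Nat.Partrec f) :
    ∃ (α : Type) (_ : Finite α) (C : List (FreeGroup α)) (y s a : α) (R : ℕ → ℕ), Primrec R ∧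
      ∀ n,
        ((f n).Dom → ∀ (G : Type) [Group G] (v : α → G), (∀ r ∈ C, FreeGroup.lift v r = 1) →
          v a = v y ^ R n * v s * (v y ^ R n)⁻¹ → ∀ g g', Commute (v g) (v g')) ∧
        (¬ (f n).Dom → ∃ (G : Type) (_ : Group G) (v : α → G),
          (∀ r ∈ C, FreeGroup.lift v r = 1) ∧ v a = v y ^ R n * v s * (v y ^ R n)⁻¹ ∧
          ∃ g g', ¬ Commute (v g) (v g')) := by
  obtain ⟨β, _, Q, y, s, k, a, R, hQ, hR, h⟩ := exists_relators_of_partrec hf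
  obtain ⟨idx, hidx⟩ := Countable.exists_injective_nat (β ⊕ Bool)
  obtain ⟨C, hC⟩ := (hQ.comap CollapseGen.base).and
    (CollapseGen.isFinitelyRelated_isCollapsing idx k a)
  refine ⟨CollapseGen β, inferInstance, C, .base y, .base s, .base a, R, hR, fun n =>
    ⟨fun hn G _ v hv ha => ?_, fun hn => ?_⟩⟩
  · obtain ⟨hv₁, hv₂⟩ := (hC G v).2 hv
    exact CollapseGen.commute_of_isCollapsing hv₂ ((h n).1 hn G _ hv₁ ha)
  · obtain ⟨M, _, u, hu, ha, horder⟩ := (h n).2 hn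
    obtain ⟨G, _, j, v, hv, hcol, hne⟩ := CollapseGen.exists_isCollapsing hidx u horder
    refine ⟨G, _, v, (hC G v).1 ⟨?_, hcol⟩, ?_, _, _, hne⟩
    · simp only [hv]
      obtain ⟨D, hD⟩ := hQ
      refine (hD G _).2 fun r hr => ?_
      have : FreeGroup.lift (fun b => j (u b)) r = j (FreeGroup.lift u r) :=
        DFunLike.congr_fun (g := j.comp (FreeGroup.lift u)) (by ext; simp) r
      rw [this, (hD M u).1 hu r hr, map_one]
    · simp only [hv, ha, map_mul, map_inv, map_pow]

theorem Primrec.list_replicate {α : Type*} [Primcodable α] :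
    Primrec₂ (List.replicate : ℕ → α → List α) :=
  (Primrec.list_map (Primrec.list_range.comp Primrec.fst)
    (Primrec.snd.comp Primrec.fst).to₂).of_eq fun p => by simp

theorem exists_presentations_of_partrec {f : ℕ →. ℕ} (hf : Nat.Partrec f) (N : ℕ) :
    ∃ (m : ℕ) (block : Fin m → Fin N) (L : ℕ → List (Word m)), Primrec L ∧ ∀ n,
      (∀ x y, (block x = block y → (f (Nat.pair n (block x))).Dom) →
        Commute (FinPres.proj ⟨m, L n⟩ (.of x)) (FinPres.proj ⟨m, L n⟩ (.of y))) ∧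
      ∀ i : Fin N, ¬ (f (Nat.pair n i)).Dom → ∃ a b : FinPres.Grp ⟨m, L n⟩, ¬ Commute a b := by
  classical
  obtain ⟨α, _, C, y, s, a, R, hR, h⟩ := exists_collapsing_relators_of_partrec hf
  let e : Fin N × α ≃ Fin (Nat.card (Fin N × α)) := Finite.equivFin _
  let B : List (Word (Nat.card (Fin N × α))) := (List.finRange N).flatMap fun i =>
    C.map fun r => (FreeGroup.map (fun g => e (i, g)) r).toWord
  let D : List (Word (Nat.card (Fin N × α))) := (List.finRange _).flatMap fun x =>
    (List.finRange _).flatMap fun y => if (e.symm x).1 = (e.symm y).1 then [] else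
      [[(x, true), (y, true), (x, false), (y, false)]]
  let T (n : ℕ) (i : Fin N) : Word (Nat.card (Fin N × α)) :=
    List.replicate (R (Nat.pair n i)) (e (i, y), true) ++ (e (i, s), true) ::
      (List.replicate (R (Nat.pair n i)) (e (i, y), false) ++ [(e (i, a), false)])
  let L (n : ℕ) : List (Word (Nat.card (Fin N × α))) := B ++ D ++ (List.finRange N).map (T n)
  have hL {G : Type} [Group G] (n : ℕ) (v : Fin (Nat.card (Fin N × α)) → G) :
      (∀ w ∈ L n, FreeGroup.lift v (.mk w) = 1) ↔
        (∀ i, (∀ r ∈ C, FreeGroup.lift (fun g => v (e (i, g))) r = 1) ∧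
          v (e (i, a)) = v (e (i, y)) ^ R (Nat.pair n i) * v (e (i, s)) *
            (v (e (i, y)) ^ R (Nat.pair n i))⁻¹) ∧
        ∀ x x', (e.symm x).1 ≠ (e.symm x').1 → Commute (v x) (v x') := by
    have hB : (∀ w ∈ B, FreeGroup.lift v (.mk w) = 1) ↔
        ∀ i, ∀ r ∈ C, FreeGroup.lift (fun g => v (e (i, g))) r = 1 := by
      have hlift (i : Fin N) (r : FreeGroup α) : FreeGroup.lift v (FreeGroup.map (fun g => e (i, g)) r) =
          FreeGroup.lift (fun g => v (e (i, g))) r :=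
        DFunLike.congr_fun (f := (FreeGroup.lift v).comp (FreeGroup.map _)) (by ext; simp) r
      simp only [B, List.forall_mem_flatMap, List.forall_mem_map, FreeGroup.mk_toWord, hlift,
        List.mem_finRange, forall_const]
    have hD : (∀ w ∈ D, FreeGroup.lift v (.mk w) = 1) ↔
        ∀ x x', (e.symm x).1 ≠ (e.symm x').1 → Commute (v x) (v x') := by
      simp only [D, List.forall_mem_flatMap, List.mem_finRange, forall_const]
      refine forall₂_congr fun x x' => ?_
      split_ifs with hxx'
      · simp [hxx']
      · simp [hxx', ← mul_assoc, mul_inv_eq_iff_eq_mul, commute_iff_eq]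
    have hT : (∀ w ∈ (List.finRange N).map (T n), FreeGroup.lift v (.mk w) = 1) ↔
        ∀ i, v (e (i, a)) = v (e (i, y)) ^ R (Nat.pair n i) * v (e (i, s)) *
            (v (e (i, y)) ^ R (Nat.pair n i))⁻¹ := by
      simp only [List.forall_mem_map, List.mem_finRange, forall_const]
      refine forall_congr' fun i => ?_
      have hword : FreeGroup.lift v (.mk (T n i)) = v (e (i, y)) ^ R (Nat.pair n i) *
          v (e (i, s)) * (v (e (i, y)) ^ R (Nat.pair n i))⁻¹ * (v (e (i, a)))⁻¹ := by
        simp [T, mul_assoc]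
      rw [hword, mul_inv_eq_one, eq_comm]
    rw [List.forall_mem_append, List.forall_mem_append, hB, hD, hT, forall_and]
    tauto
  refine ⟨_, fun x => (e.symm x).1, L, ?_, fun n => ⟨fun x x' hx => ?_, fun i hi => ?_⟩⟩
  · have hT : Primrec₂ T := by
      have hq : Primrec₂ fun n (i : Fin N) => R (Nat.pair n i) :=
        hR.comp₂ (Primrec₂.natPair.comp Primrec.fst (Primrec.fin_val.comp Primrec.snd))
      have hletter (g : α) (b : Bool) : Primrec₂ fun (_ : ℕ) (i : Fin N) => (e (i, g), b) :=
        ((Primrec.dom_finite fun i => (e (i, g), b)).comp Primrec.snd).to₂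
      exact Primrec.list_append.comp (Primrec.list_replicate.comp hq (hletter y true))
        (Primrec.list_cons.comp (hletter s true)
          (Primrec.list_append.comp (Primrec.list_replicate.comp hq (hletter y false))
            (Primrec.list_cons.comp (hletter a false) (Primrec.const []))))
    exact Primrec.list_append.comp (Primrec.const (B ++ D)) (Primrec.list_map (Primrec.const _) hT)
  · obtain ⟨h₁, h₂⟩ := (hL n fun x => FinPres.proj ⟨_, L n⟩ (.of x)).1 fun w hw => by
      have hlift : FreeGroup.lift (fun x => FinPres.proj ⟨_, L n⟩ (.of x)) =
          FinPres.proj ⟨_, L n⟩ := by ext; simp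
      rw [hlift]
      exact PresentedGroup.one_of_mem ⟨w, hw, rfl⟩
    by_cases hxx' : (e.symm x).1 = (e.symm x').1
    · have := (h _).1 (hx hxx') _ _ (h₁ _).1 (h₁ _).2 (e.symm x).2 (e.symm x').2
      have hx' : ((e.symm x).1, (e.symm x').2) = e.symm x' := by rw [hxx']
      simpa [hx'] using this
    · exact h₂ x x' hxx'
  · obtain ⟨G, _, u, hu, ha, g, g', hne⟩ := (h _).2 hi
    let v (x : Fin (Nat.card (Fin N × α))) : G :=
      if (e.symm x).1 = i then u (e.symm x).2 else 1
    have hv : ∀ w ∈ L n, FreeGroup.lift v (.mk w) = 1 := by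
      refine (hL n v).2 ⟨fun i' => ?_, fun x x' hxx' => ?_⟩
      · by_cases hi' : i' = i
        · subst hi'
          simpa [v] using ⟨hu, ha⟩
        · simp only [v, Equiv.symm_apply_apply, if_neg hi']
          refine ⟨fun r hr => ?_, by simp⟩
          exact DFunLike.congr_fun (g := (1 : FreeGroup α →* G)) (by ext; simp) r
      · by_cases hx : (e.symm x).1 = i
        · have : (e.symm x').1 ≠ i := fun h => hxx' (hx.trans h.symm)
          simp [v, this]
        · simp [v, hx]
    let φ : FinPres.Grp ⟨_, L n⟩ →* G := PresentedGroup.toGroup (f := v) (by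
      rintro _ ⟨r, hr, rfl⟩; exact hv r hr)
    refine ⟨.of (e (i, g)), .of (e (i, g')), fun hcomm => hne ?_⟩
    have := hcomm.map φ
    simpa [φ, v] using this

theorem FinPres.commute_proj_mk {P : FinPres} {w w' : Word P.1}
    (h : ∀ x ∈ w, ∀ y ∈ w', Commute (P.proj (.of x.1)) (P.proj (.of y.1))) :
    Commute (P.proj (.mk w)) (P.proj (.mk w')) := by
  have hlift : P.proj = FreeGroup.lift fun x => P.proj (.of x) := by ext; simp
  rw [hlift, FreeGroup.lift_mk, FreeGroup.lift_mk]
  refine Commute.list_prod_left _ _ fun a ha => Commute.list_prod_right _ _ fun b hb => ?_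
  obtain ⟨x, hx, rfl⟩ := List.mem_map.1 ha
  obtain ⟨y, hy, rfl⟩ := List.mem_map.1 hb
  have := h x hx y hy
  cases x.2 <;> cases y.2 <;> simpa using this

/-- Theorem B (Chiodo): for any `k > 0` there is no algorithm that, on input of a finite
presentation of a non-abelian group, halts and outputs two words, each of length at
most `k`, whose images in the presented group do not commute. -/
theorem no_algorithm_bounded_noncommuting_words (k : ℕ) (hk : 0 < k) :
    ¬ ∃ g : ℕ →. ℕ, Nat.Partrec g ∧
      ∀ P : FinPres, (∃ a b : P.Grp, ¬ Commute a b) →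
        ∃ w w' : Word P.1,
          Encodable.encode (w, w') ∈ g (Encodable.encode P) ∧
          w.length ≤ k ∧ w'.length ≤ k ∧
          ¬ Commute (P.proj (FreeGroup.mk w)) (P.proj (FreeGroup.mk w')) := by
  rintro ⟨g, hg, hspec⟩
  have huniv : Nat.Partrec fun n =>
      Nat.Partrec.Code.eval (Denumerable.ofNat Nat.Partrec.Code n.unpair.1) n.unpair.2 :=
    Partrec.nat_iff.1 <| Nat.Partrec.Code.eval_part.comp
      ((Computable.ofNat _).comp (Primrec.fst.comp Primrec.unpair).to_comp)
      (Primrec.snd.comp Primrec.unpair).to_comp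
  obtain ⟨m, block, L, hL, hLspec⟩ := exists_presentations_of_partrec huniv (2 * k + 1)
  let blocks (r : ℕ) : List ℕ :=
    ((Encodable.decode r : Option (Word m × Word m)).map fun p =>
      (p.1 ++ p.2).map fun l => (block l.1 : ℕ)).getD []
  have hblocks : Primrec blocks := by
    refine Primrec.option_getD.comp (Primrec.option_map Primrec.decode ?_) (Primrec.const [])
    exact Primrec.list_map (Primrec.list_append.comp (Primrec.fst.comp Primrec.snd)
      (Primrec.snd.comp Primrec.snd)) ((Primrec.dom_finite fun l : Fin m × Bool =>
        (block l.1 : ℕ)).comp Primrec.snd).to₂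
  let test (r i : ℕ) : Bool :=
    decide ((blocks r).length ≤ 2 * k) && decide ((blocks r).idxOf i < (blocks r).length)
  have htest : Primrec₂ test := by
    have hlen : Primrec₂ fun r (_ : ℕ) => (blocks r).length :=
      Primrec.list_length.comp (hblocks.comp Primrec.fst)
    refine Primrec.and.comp ?_ ?_
    · exact (Primrec.nat_le.comp hlen (Primrec.const _)).decide
    · exact (Primrec.nat_lt.comp
        (Primrec.list_idxOf.comp Primrec.snd (hblocks.comp Primrec.fst)) hlen).decide
  let P (c : Nat.Partrec.Code) : FinPres := ⟨m, L (Encodable.encode c)⟩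
  have hP : Computable fun c => Encodable.encode (P c) :=
    (Primrec₂.natPair.comp (Primrec.const _)
      (Primrec.encode.comp (hL.comp Primrec.encode))).to_comp
  obtain ⟨c, hc⟩ := Nat.Partrec.Code.fixed_point₂
    (f := fun c i => (g (Encodable.encode (P c))).bind fun r =>
      ((if test r i then some 0 else none : Option ℕ) : Part ℕ)) (by
    refine Partrec.bind ((Partrec.nat_iff.2 hg).comp (hP.comp Computable.fst)) ?_
    refine Computable.ofOption (Primrec.to_comp ?_)
    exact Primrec.ite (Primrec.eq.comp (htest.comp Primrec.snd (Primrec.snd.comp Primrec.fst))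
      (Primrec.const true)) (Primrec.const _) (Primrec.const _))
  have hdom (i : ℕ) : (Nat.Partrec.Code.eval c i).Dom ↔ ∃ r ∈ g (Encodable.encode (P c)),
      (blocks r).length ≤ 2 * k ∧ i ∈ blocks r := by
    rw [hc]
    simp only [Part.dom_iff_mem, Part.mem_bind_iff, Part.mem_ofOption]
    refine ⟨fun ⟨_, r, hr, h⟩ => ?_, fun ⟨r, hr, h₁, h₂⟩ => ?_⟩
    · by_cases ht : test r i = true
      · simp only [test, Bool.and_eq_true, decide_eq_true_eq, List.idxOf_lt_length_iff] at ht
        exact ⟨r, hr, ht⟩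
      · simp [ht] at h
    · have ht : test r i = true := by
        simp only [test, Bool.and_eq_true, decide_eq_true_eq, List.idxOf_lt_length_iff]
        exact ⟨h₁, h₂⟩
      exact ⟨0, r, hr, by simp [ht]⟩
  have hspec' := hLspec (Encodable.encode c)
  simp only [Nat.unpair_pair, Denumerable.ofNat_encode] at hspec'
  obtain ⟨i, hi⟩ : ∃ i : Fin (2 * k + 1), ¬ (Nat.Partrec.Code.eval c i).Dom := by
    by_contra! h
    obtain ⟨r, hr, hlen, -⟩ := (hdom _).1 (h 0)
    have hsub : Finset.range (2 * k + 1) ⊆ (blocks r).toFinset := fun i hi => by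
      obtain ⟨r', hr', -, hi'⟩ := (hdom _).1 (h ⟨i, Finset.mem_range.1 hi⟩)
      rwa [List.mem_toFinset, Part.mem_unique hr hr']
    have := (Finset.card_le_card hsub).trans (List.toFinset_card_le _)
    rw [Finset.card_range] at this
    omega
  obtain ⟨w, w', hmem, hw, hw', hne⟩ := hspec (P c) (hspec'.2 i hi)
  have hb : blocks (Encodable.encode (w, w')) = (w ++ w').map fun l => (block l.1 : ℕ) := by
    simp only [blocks, Encodable.encodek, Option.map_some, Option.getD_some]
    rfl
  have hhalt (x : Fin m × Bool) (hx : x ∈ w ++ w') : (Nat.Partrec.Code.eval c (block x.1)).Dom := by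
    refine (hdom _).2 ⟨_, hmem, ?_, ?_⟩
    · rw [hb, List.length_map, List.length_append]; omega
    · rw [hb]; exact List.mem_map_of_mem hx
  exact hne <| FinPres.commute_proj_mk fun x hx y _ =>
    hspec'.1 x.1 y.1 fun _ => hhalt x (List.mem_append_left _ hx)
end
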